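/- Let A be a nonempty finite set, let Q_X and Q_Y be strictly positive stochastic matrices on A with stationary probability vectors mu and mu~, and let P, P~ be the stationary Markov measures determined by (Q_X, mu) and (Q_Y, mu~). For p in (-1,1) let Lambda(p) := lim_{n->infinity} (1/n) log E_{P tensor P~ tensor P} ( ( W_n(X|Y) / W_n(X|X') )^p ), which exists and is finite. Then the function Lambda is real-analytic and convex on the open interval (-1,1). -/

import Mathlib

open MeasureTheory Filter Finset Real

/-- Waiting time: `W_n(x|y) = inf { k ≥ 1 : y_{k+i} = x_i for all 1 ≤ i ≤ n }`
(with the convention `sInf ∅ = 0` in `ℕ`; the set is a.s. nonempty). -/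
noncomputable def waitingTime {A : Type*} (n : ℕ) (x y : ℕ → A) : ℕ :=
  sInf {k | 1 ≤ k ∧ ∀ i, 1 ≤ i → i ≤ n → y (k + i) = x i}

section helpers

lemma aux_pos_mul {A : Type*} [Fintype A] (M : A → A → ℝ) (hM : ∀ a b, 0 < M a b)
    (v : A → ℝ) (hv : ∀ a, 0 ≤ v a) (hne : ∃ a, v a ≠ 0) (a : A) : 0 < ∑ b, M a b * v b := by
  obtain ⟨c, hc⟩ := hne
  have hc' : 0 < v c := lt_of_le_of_ne (hv c) (Ne.symm hc)
  exact Finset.sum_pos' (fun b _ => mul_nonneg (hM a b).le (hv b))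
    ⟨c, Finset.mem_univ c, mul_pos (hM a c) hc'⟩

lemma perron_exists {A : Type*} [Fintype A] [Nonempty A] (M : A → A → ℝ)
    (hM : ∀ a b, 0 < M a b) :
    ∃ l : ℝ, 0 < l ∧ ∃ v : A → ℝ, (∀ a, 0 < v a) ∧ ∑ a, v a = 1 ∧
      ∀ a, ∑ b, M a b * v b = l * v a := by
  classical
  set T : ℝ := ∑ a, ∑ b, M a b with hT
  have hTnn : 0 ≤ T := Finset.sum_nonneg fun a _ => Finset.sum_nonneg fun b _ => (hM a b).le
  let S : Set ((A → ℝ) × ℝ) :=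
    (stdSimplex ℝ A ×ˢ Set.Icc 0 T) ∩ {z | ∀ a, z.2 * z.1 a ≤ ∑ b, M a b * z.1 b}
  have hScomp : IsCompact S := by
    apply IsCompact.inter_right ((isCompact_stdSimplex ℝ A).prod isCompact_Icc)
    simp only [Set.ofPred_forall]
    refine isClosed_iInter fun a => isClosed_le (by fun_prop) (by fun_prop)
  have hSne : S.Nonempty := by
    obtain ⟨a0⟩ := ‹Nonempty A›
    refine ⟨(Pi.single a0 1, 0), ⟨⟨single_mem_stdSimplex ℝ a0, ⟨le_refl _, hTnn⟩⟩, ?_⟩⟩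
    intro a
    simp only [zero_mul]
    exact Finset.sum_nonneg fun b _ => mul_nonneg (hM a b).le
      ((single_mem_stdSimplex ℝ a0).1 b)
  obtain ⟨⟨v, t⟩, ⟨⟨⟨hv0, hv1⟩, ht0, htT⟩, hvt⟩, hmax⟩ :=
    hScomp.exists_isMaxOn hSne (f := fun z => z.2) (by fun_prop)
  simp only at hv0 hv1 ht0 htT hvt
  have hvne : ∃ a, v a ≠ 0 := by
    by_contra! h
    simp [h] at hv1
  set u : A → ℝ := fun a => ∑ b, M a b * v b with hu
  have hupos : ∀ a, 0 < u a := aux_pos_mul M hM v hv0 hvne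
  have key : ∀ a, u a = t * v a := by
    by_contra! hcon
    obtain ⟨c, hc⟩ := hcon
    have hz : ∀ a, 0 < ∑ b, M a b * (u b - t * v b) :=
      aux_pos_mul M hM _ (fun a => sub_nonneg.2 (hvt a)) ⟨c, sub_ne_zero.2 hc⟩
    have hz' : ∀ a, ∑ b, M a b * (u b - t * v b) = ∑ b, M a b * u b - t * u a := by
      intro a
      simp only [mul_sub, Finset.sum_sub_distrib, hu, Finset.mul_sum]
      congr 1
      exact Finset.sum_congr rfl fun b _ => by ring
    obtain ⟨a1, _, ha1⟩ := Finset.exists_min_image Finset.univ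
      (fun a => (∑ b, M a b * (u b - t * v b)) / u a) Finset.univ_nonempty
    set ε := (∑ b, M a1 b * (u b - t * v b)) / u a1 with hε
    have hεpos : 0 < ε := div_pos (hz a1) (hupos a1)
    have hge : ∀ a, (t + ε) * u a ≤ ∑ b, M a b * u b := by
      intro a
      have := ha1 a (Finset.mem_univ a)
      rw [le_div_iff₀ (hupos a), hz'] at this
      linarith
    set s := ∑ a, u a with hs
    have hspos : 0 < s := Finset.sum_pos (fun a _ => hupos a) Finset.univ_nonempty
    have hmem1 : (fun a => u a / s) ∈ stdSimplex ℝ A := by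
      refine ⟨fun a => (div_pos (hupos a) hspos).le, ?_⟩
      rw [← Finset.sum_div, div_self hspos.ne']
    have hge' : ∀ a, (t + ε) * (u a / s) ≤ ∑ b, M a b * (u b / s) := by
      intro a
      have h1 : ∑ b, M a b * (u b / s) = (∑ b, M a b * u b) / s := by
        rw [Finset.sum_div]
        exact Finset.sum_congr rfl fun b _ => by ring
      rw [h1, ← mul_div_assoc]
      exact div_le_div_of_nonneg_right (hge a) hspos.le
    have hleT : t + ε ≤ T := by
      have h2 : ∑ a, (t + ε) * (u a / s) ≤ ∑ a, ∑ b, M a b * (u b / s) :=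
        Finset.sum_le_sum fun a _ => hge' a
      rw [← Finset.mul_sum, hmem1.2, mul_one] at h2
      refine h2.trans (Finset.sum_le_sum fun a _ => Finset.sum_le_sum fun b _ => ?_)
      refine mul_le_of_le_one_right (hM a b).le ?_
      rw [div_le_one hspos]
      exact Finset.single_le_sum (fun a _ => (hupos a).le) (Finset.mem_univ b)
    have hmemS : ((fun a => u a / s), t + ε) ∈ S :=
      ⟨⟨hmem1, ⟨by positivity, hleT⟩⟩, hge'⟩
    have := hmax hmemS
    simp only [Set.mem_ofPred_eq] at this
    linarith
  have htpos : 0 < t := by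
    obtain ⟨a0⟩ := ‹Nonempty A›
    have := hupos a0
    rw [key] at this
    rcases ht0.lt_or_eq with h | h
    · exact h
    · rw [← h] at this; simp at this
  refine ⟨t, htpos, v, fun a => ?_, hv1, key⟩
  have := hupos a
  rw [key] at this
  exact (pos_iff_pos_of_mul_pos this).1 htpos

lemma perron_ker {A : Type*} [Fintype A] [Nonempty A] (M : A → A → ℝ)
    (hM : ∀ a b, 0 < M a b) (l : ℝ) (v u : A → ℝ) (hv : ∀ a, 0 < v a)
    (hMv : ∀ a, ∑ b, M a b * v b = l * v a) (hMu : ∀ a, ∑ b, M a b * u b = l * u a) :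
    ∃ t : ℝ, ∀ a, u a = t * v a := by
  obtain ⟨a1, _, ha1⟩ := Finset.exists_min_image Finset.univ
      (fun a => u a / v a) Finset.univ_nonempty
  set t := u a1 / v a1 with ht
  refine ⟨t, ?_⟩
  by_contra! hcon
  obtain ⟨c, hc⟩ := hcon
  have h := aux_pos_mul M hM (fun a => u a - t * v a) (fun a => by
    have := ha1 a (Finset.mem_univ a)
    rw [le_div_iff₀ (hv a)] at this
    linarith) ⟨c, sub_ne_zero.2 hc⟩ a1
  have h2 : ∑ b, M a1 b * (u b - t * v b) = l * (u a1 - t * v a1) := by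
    have : ∀ b, M a1 b * (u b - t * v b) = M a1 b * u b - t * (M a1 b * v b) := fun b => by ring
    simp only [this, Finset.sum_sub_distrib, ← Finset.mul_sum, hMv, hMu]
    ring
  rw [h2, ht, div_mul_cancel₀ _ (hv a1).ne'] at h
  simp at h

/-- Local analytic branch of the Perron eigenpair. -/
lemma perron_analytic {A : Type*} [Fintype A] [Nonempty A] (M : ℝ → A → A → ℝ)
    (hM : ∀ p a b, 0 < M p a b) (hMa : ∀ a b, ContDiff ℝ ⊤ (fun p => M p a b)) (p0 : ℝ) :
    ∃ l : ℝ → ℝ, AnalyticAt ℝ l p0 ∧ 0 < l p0 ∧ ∀ᶠ p in nhds p0, ∃ v : A → ℝ,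
      (∀ a, 0 < v a) ∧ ∀ a, ∑ b, M p a b * v b = l p * v a := by
  obtain ⟨l0, hl0, v0, hv0, hv0s, hMv0⟩ := perron_exists (M p0) (hM p0)
  obtain ⟨l1, hl1, w, hw, -, hMw⟩ := perron_exists (fun a b => M p0 b a) (fun a b => hM p0 b a)
  have hpair : ∀ u : A → ℝ, ∑ a, w a * ∑ b, M p0 a b * u b = l1 * ∑ a, w a * u a := by
    intro u
    simp only [Finset.mul_sum]
    rw [Finset.sum_comm]
    refine Finset.sum_congr rfl fun b _ => ?_
    have := hMw b
    calc ∑ a, w a * (M p0 a b * u b) = (∑ a, M p0 a b * w a) * u b := by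
          rw [Finset.sum_mul]; exact Finset.sum_congr rfl fun a _ => by ring
      _ = _ := by rw [this]; ring
  have hwv : 0 < ∑ a, w a * v0 a :=
    Finset.sum_pos (fun a _ => mul_pos (hw a) (hv0 a)) Finset.univ_nonempty
  have hl : l1 = l0 := by
    have h := hpair v0
    simp only [hMv0] at h
    have h2 : ∑ a, w a * (l0 * v0 a) = l0 * ∑ a, w a * v0 a := by
      rw [Finset.mul_sum]; exact Finset.sum_congr rfl fun a _ => by ring
    rw [h2] at h
    exact (mul_right_cancel₀ hwv.ne' h).symm
  subst hl
  let F : ((A → ℝ) × ℝ) × ℝ → ((A → ℝ) × ℝ) × ℝ := fun z =>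
    ((fun a => ∑ b, M z.2 a b * z.1.1 b - z.1.2 * z.1.1 a, ∑ a, z.1.1 a), z.2)
  set z0 : ((A → ℝ) × ℝ) × ℝ := ((v0, l1), p0) with hz0
  have hFc : ContDiff ℝ ⊤ F := by
    refine ContDiff.prodMk (ContDiff.prodMk (contDiff_pi.2 fun a => ?_) ?_) contDiff_snd
    · refine ContDiff.sub (ContDiff.sum fun b _ => ContDiff.mul ((hMa a b).comp contDiff_snd) ?_) ?_
      · fun_prop
      · fun_prop
    · fun_prop
  have hFd : HasFDerivAt F (fderiv ℝ F z0) z0 :=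
    (hFc.differentiable (by simp)).differentiableAt.hasFDerivAt
  -- compute the derivative along lines
  have hinj : Function.Injective (fderiv ℝ F z0) := by
    rw [injective_iff_map_eq_zero]
    rintro ⟨⟨u, s⟩, r⟩ h
    have hline : HasDerivAt (fun t : ℝ => z0 + t • (((u, s), r) : ((A → ℝ) × ℝ) × ℝ))
        ((u, s), r) 0 := by
      simpa using ((hasDerivAt_id (0:ℝ)).smul_const (((u, s), r) : ((A → ℝ) × ℝ) × ℝ)).const_add z0
    have hcomp : HasDerivAt (fun t : ℝ => F (z0 + t • (((u, s), r) : ((A → ℝ) × ℝ) × ℝ)))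
        0 0 := by
      have h' : HasFDerivAt F (fderiv ℝ F z0) (z0 + (0:ℝ) • (((u, s), r) : ((A → ℝ) × ℝ) × ℝ)) := by
        simpa using hFd
      have := h'.comp_hasDerivAt (0:ℝ) hline
      rw [h] at this
      exact this
    have hr : r = 0 := by
      have h1 := hcomp.snd
      have h2 : HasDerivAt (fun t : ℝ => p0 + t * r) r 0 := by
        simpa using ((hasDerivAt_id (0:ℝ)).mul_const r).const_add p0
      exact h2.unique h1
    subst hr
    have hsum : ∑ a, u a = 0 := by
      have h1 := hcomp.fst.snd
      have h2 : HasDerivAt (fun t : ℝ => ∑ a, (v0 a + t * u a)) (∑ a, u a) 0 := by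
        refine HasDerivAt.fun_sum fun a _ => ?_
        simpa using ((hasDerivAt_id (0:ℝ)).mul_const (u a)).const_add (v0 a)
      exact h2.unique h1
    have hA : ∀ a, ∑ b, M p0 a b * u b - (l1 * u a + s * v0 a) = 0 := by
      intro a
      have h1 := (hasDerivAt_pi.1 hcomp.fst.fst) a
      have h2 : HasDerivAt (fun t : ℝ => ∑ b, M (p0 + t * 0) a b * (v0 b + t * u b)
          - (l1 + t * s) * (v0 a + t * u a))
          (∑ b, M p0 a b * u b - (l1 * u a + s * v0 a)) 0 := by
        have hlin : ∀ c d : ℝ, HasDerivAt (fun t : ℝ => c + t * d) d 0 := fun c d => by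
          simpa using ((hasDerivAt_id (0:ℝ)).mul_const d).const_add c
        simp only [mul_zero, add_zero]
        refine HasDerivAt.sub (HasDerivAt.fun_sum fun b _ => (hlin _ _).const_mul _) ?_
        have := (hlin l1 s).mul (hlin (v0 a) (u a))
        simp only [zero_mul, add_zero] at this
        rw [add_comm]
        exact this
      exact h2.unique h1
    have hs : s = 0 := by
      have h := hpair u
      have h3 : ∀ a, ∑ b, M p0 a b * u b = l1 * u a + s * v0 a := fun a => by linarith [hA a]
      simp only [h3] at h
      have h2 : ∑ a, w a * (l1 * u a + s * v0 a) = l1 * ∑ a, w a * u a + s * ∑ a, w a * v0 a := by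
        rw [Finset.mul_sum, Finset.mul_sum, ← Finset.sum_add_distrib]
        exact Finset.sum_congr rfl fun a _ => by ring
      rw [h2] at h
      have : s * ∑ a, w a * v0 a = 0 := by linarith
      exact (mul_eq_zero.1 this).resolve_right hwv.ne'
    subst hs
    obtain ⟨t, ht⟩ := perron_ker (M p0) (hM p0) l1 v0 u hv0 hMv0 (fun a => by linarith [hA a])
    have ht0 : t = 0 := by
      simp only [ht, ← Finset.mul_sum, hv0s, mul_one] at hsum
      exact hsum
    have : u = 0 := by
      funext a; simp [ht a, ht0]
    rw [this]; rfl
  let e : (((A → ℝ) × ℝ) × ℝ) ≃L[ℝ] (((A → ℝ) × ℝ) × ℝ) :=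
    (LinearEquiv.ofInjectiveEndo (fderiv ℝ F z0).toLinearMap hinj).toContinuousLinearEquiv
  have he : HasFDerivAt F (e : (((A → ℝ) × ℝ) × ℝ) →L[ℝ] (((A → ℝ) × ℝ) × ℝ)) z0 := by
    have : (e : (((A → ℝ) × ℝ) × ℝ) →L[ℝ] (((A → ℝ) × ℝ) × ℝ)) = fderiv ℝ F z0 := by
      ext x <;> rfl
    rw [this]; exact hFd
  have hFat : ContDiffAt ℝ ⊤ F z0 := hFc.contDiffAt
  set G := hFat.localInverse he (by simp) with hG
  have hFz0 : F z0 = ((0, 1), p0) := by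
    simp only [F, hz0, hMv0, hv0s]
    simp; rfl
  have hGc : ContDiffAt ℝ ⊤ G ((0, 1), p0) := by
    rw [← hFz0]; exact hFat.to_localInverse he (by simp)
  have hGz : G ((0, 1), p0) = z0 := by
    rw [← hFz0]; exact hFat.localInverse_apply_image he (by simp)
  have hright : ∀ᶠ y in nhds (((0, 1), p0) : ((A → ℝ) × ℝ) × ℝ), F (G y) = y := by
    rw [← hFz0]
    exact (hFat.hasStrictFDerivAt' he (by simp)).eventually_right_inverse
  let c : ℝ → ((A → ℝ) × ℝ) × ℝ := fun p => ((0, 1), p)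
  have hc : ContDiff ℝ ⊤ c := by
    exact ContDiff.prodMk contDiff_const contDiff_id
  have hcc : ContinuousAt c p0 := hc.continuous.continuousAt
  have hGcomp : ContDiffAt ℝ ⊤ (fun p => G (c p)) p0 :=
    ContDiffAt.comp p0 (f := c) hGc hc.contDiffAt
  have hGcont : ContinuousAt (fun p => G (c p)) p0 := hGcomp.continuousAt
  refine ⟨fun p => (G (c p)).1.2, ?_, ?_, ?_⟩
  · have : ContDiffAt ℝ ⊤ (fun p => (G (c p)).1.2) p0 := hGcomp.fst.snd
    exact this.analyticAt
  · show 0 < (G ((0, 1), p0)).1.2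
    rw [hGz]; exact hl0
  · have hpos : ∀ᶠ p in nhds p0, ∀ a, 0 < (G (c p)).1.1 a := by
      rw [Filter.eventually_all]
      intro a
      have h1 : ContinuousAt (fun p => (G (c p)).1.1 a) p0 :=
        (continuous_apply a).continuousAt.comp hGcont.fst.fst
      refine h1.eventually (eventually_gt_nhds ?_)
      show 0 < (G ((0, 1), p0)).1.1 a
      rw [hGz]; exact hv0 a
    filter_upwards [hpos, hcc.eventually hright] with p hp1 hp2
    refine ⟨(G (c p)).1.1, hp1, fun a => ?_⟩
    have h2 : (G (c p)).2 = p := congrArg Prod.snd hp2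
    have h3 := congrFun (congrArg (fun z => z.1.1) hp2) a
    simp only [F, c, h2, Pi.zero_apply] at h3
    linarith

open scoped ENNReal

/-- `f` depends only on coordinates `≤ k`. -/
def DepLe {A B : Type*} (k : ℕ) (f : (ℕ → A) → B) : Prop :=
  ∀ x y : ℕ → A, (∀ i ≤ k, x i = y i) → f x = f y

/-- extension of a finite word -/
def extWord {A : Type*} (k : ℕ) (c : Fin (k + 1) → A) : ℕ → A :=
  fun i => c ⟨min i k, by omega⟩

lemma extWord_apply {A : Type*} (k : ℕ) (c : Fin (k + 1) → A) (i : ℕ) (hi : i ≤ k) :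
    extWord k c i = c ⟨i, by omega⟩ := by
  simp [extWord, hi]

lemma DepLe.measurable {A B : Type*} [Fintype A] [MeasurableSpace A] [MeasurableSingletonClass A]
    [MeasurableSpace B] {k : ℕ} {f : (ℕ → A) → B} (hf : DepLe k f) : Measurable f := by
  have h : f = (fun c => f (extWord k c)) ∘ (fun ω : ℕ → A => fun i : Fin (k + 1) => ω i) := by
    funext ω
    exact hf _ _ fun i hi => by simp [extWord_apply, hi]
  rw [h]
  exact (Measurable.of_discrete).comp (measurable_pi_lambda _ fun i => measurable_pi_apply _)

/-- The Markov property in functional form. -/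
def MarkovProp {A : Type*} [MeasurableSpace A] (P : Measure (ℕ → A)) (Q : A → A → ℝ) : Prop :=
  ∀ (k : ℕ) (f : (ℕ → A) → ℝ≥0∞), DepLe k f → ∀ b : A,
    ∫⁻ ω, f ω * Set.indicator {ω | ω (k + 1) = b} 1 ω ∂P
      = ∫⁻ ω, f ω * ENNReal.ofReal (Q (ω k) b) ∂P

lemma lintegral_rep {A : Type*} [Fintype A] [MeasurableSpace A] [MeasurableSingletonClass A]
    (P : Measure (ℕ → A)) (k : ℕ) (f : (ℕ → A) → ℝ≥0∞) (hf : DepLe k f) (E : Set (ℕ → A))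
    (hE : MeasurableSet E) :
    ∫⁻ ω, f ω * Set.indicator E 1 ω ∂P
      = ∑ c : Fin (k + 1) → A, f (extWord k c) * P ({ω | ∀ i ≤ k, ω i = extWord k c i} ∩ E) := by
  classical
  have hcyl : ∀ c : Fin (k + 1) → A, MeasurableSet {ω : ℕ → A | ∀ i ≤ k, ω i = extWord k c i} := by
    intro c
    simp only [Set.ofPred_forall]
    refine MeasurableSet.iInter fun i => MeasurableSet.iInter fun _ => ?_
    exact (measurable_pi_apply i) (measurableSet_singleton _)
  have hpt : ∀ ω, f ω * Set.indicator E 1 ω = ∑ c : Fin (k + 1) → A,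
      f (extWord k c) * Set.indicator ({ω | ∀ i ≤ k, ω i = extWord k c i} ∩ E) 1 ω := by
    intro ω
    rw [Finset.sum_eq_single (fun i : Fin (k + 1) => ω i)]
    · have h1 : f (extWord k fun i : Fin (k + 1) => ω i) = f ω :=
        hf _ _ fun i hi => by simp [extWord_apply, hi]
      rw [h1]
      congr 1
      by_cases h : ω ∈ E
      · rw [Set.indicator_of_mem h, Set.indicator_of_mem]
        exact ⟨fun i hi => by simp [extWord_apply, hi], h⟩
      · rw [Set.indicator_of_notMem h, Set.indicator_of_notMem]
        exact fun h' => h h'.2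
    · intro c _ hc
      rw [Set.indicator_of_notMem, mul_zero]
      rintro ⟨h, -⟩
      apply hc
      funext i
      have := h i (by omega)
      rw [this, extWord_apply k c i (by omega)]
    · simp
  simp only [hpt]
  rw [lintegral_finsetSum]
  · refine Finset.sum_congr rfl fun c _ => ?_
    rw [lintegral_const_mul _ (measurable_one.indicator ((hcyl c).inter hE)),
      lintegral_indicator_one ((hcyl c).inter hE)]
  · intro c _
    exact (measurable_one.indicator ((hcyl c).inter hE)).const_mul _

lemma markovProp_of_cyl {A : Type*} [Fintype A] [MeasurableSpace A] [MeasurableSingletonClass A]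
    (Q : A → A → ℝ) (μ : A → ℝ) (hQpos : ∀ x y, 0 < Q x y)
    (P : Measure (ℕ → A)) [IsProbabilityMeasure P]
    (hP : ∀ (n : ℕ) (a : ℕ → A),
      (P {ω | ∀ i ≤ n, ω i = a i}).toReal
        = μ (a 0) * ∏ i ∈ Finset.range n, Q (a i) (a (i + 1))) : MarkovProp P Q := by
  classical
  intro k f hf b
  have hE : MeasurableSet {ω : ℕ → A | ω (k + 1) = b} :=
    measurableSet_preimage (measurable_pi_apply (X := fun _ : ℕ => A) (k + 1))
      (measurableSet_singleton b)
  have hr : ∀ ω : ℕ → A, f ω * ENNReal.ofReal (Q (ω k) b)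
      = (fun ω : ℕ → A => f ω * ENNReal.ofReal (Q (ω k) b)) ω * Set.indicator Set.univ 1 ω := by
    intro ω; simp
  rw [lintegral_rep P k f hf _ hE]
  rw [lintegral_congr hr]
  rw [lintegral_rep P k _ (fun x y h => by
    simp only [hf x y h, h k le_rfl]) Set.univ MeasurableSet.univ]
  refine Finset.sum_congr rfl fun c _ => ?_
  rw [mul_assoc]
  congr 1
  rw [Set.inter_univ]
  have h1 : {ω : ℕ → A | ∀ i ≤ k, ω i = extWord k c i} ∩ {ω | ω (k + 1) = b}
      = {ω | ∀ i ≤ k + 1, ω i = Function.update (extWord k c) (k + 1) b i} := by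
    ext ω
    constructor
    · rintro ⟨h1, h2⟩ i hi
      rcases Nat.lt_or_ge i (k + 1) with h | h
      · rw [Function.update_of_ne (by omega)]; exact h1 i (by omega)
      · obtain rfl : i = k + 1 := by omega
        simpa using h2
    · intro h
      refine ⟨fun i hi => ?_, ?_⟩
      · have := h i (by omega)
        rwa [Function.update_of_ne (by omega)] at this
      · have := h (k + 1) le_rfl
        simpa using this
  have h2 : ∀ S : Set (ℕ → A), P S = ENNReal.ofReal (P S).toReal := fun S =>
    (ENNReal.ofReal_toReal (measure_ne_top P S)).symm
  rw [h1, h2, hP, h2 {ω | ∀ i ≤ k, ω i = extWord k c i}, hP, ← ENNReal.ofReal_mul (hQpos _ _).le]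
  congr 1
  rw [Finset.prod_range_succ]
  have h3 : ∀ i, i ≤ k → Function.update (extWord k c) (k + 1) b i = extWord k c i :=
    fun i hi => Function.update_of_ne (by omega) _ _
  rw [h3 0 (by omega), h3 k le_rfl, Function.update_self]
  have h4 : ∏ i ∈ Finset.range k, Q (Function.update (extWord k c) (k + 1) b i)
      (Function.update (extWord k c) (k + 1) b (i + 1))
      = ∏ i ∈ Finset.range k, Q (extWord k c i) (extWord k c (i + 1)) := by
    refine Finset.prod_congr rfl fun i hi => ?_
    have := Finset.mem_range.1 hi
    rw [h3 i (by omega), h3 (i + 1) (by omega)]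
  rw [h4]; ring

/-- the word `x₁ … xₙ` occurs at position `k` -/
def winSet {A : Type*} (x : ℕ → A) (k n : ℕ) : Set (ℕ → A) :=
  {ω | ∀ i, 1 ≤ i → i ≤ n → ω (k + i) = x i}

/-- transition product -/
noncomputable def trProd {A : Type*} (Q : A → A → ℝ) (n : ℕ) (x : ℕ → A) : ℝ :=
  ∏ i ∈ Finset.range n, Q (x i) (x (i + 1))

lemma winSet_indicator_dep {A : Type*} (x : ℕ → A) (k n : ℕ) :
    DepLe (k + n) (fun ω => Set.indicator (winSet x k n) (1 : (ℕ → A) → ℝ≥0∞) ω) := by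
  classical
  intro y z h
  have : y ∈ winSet x k n ↔ z ∈ winSet x k n := by
    simp only [winSet, Set.mem_ofPred_eq]
    refine forall_congr' fun i => forall_congr' fun _ => forall_congr' fun hi => ?_
    rw [h (k + i) (by omega)]
  simp only [Set.indicator_apply, this, Pi.one_apply]

lemma winSet_measurable {A : Type*} [Fintype A] [MeasurableSpace A] [MeasurableSingletonClass A]
    (x : ℕ → A) (k n : ℕ) : MeasurableSet (winSet x k n) := by
  simp only [winSet, Set.ofPred_forall]
  refine MeasurableSet.iInter fun i => MeasurableSet.iInter fun _ => MeasurableSet.iInter fun _ => ?_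
  exact (measurable_pi_apply (k + i)) (measurableSet_singleton _)

lemma window_exact {A : Type*} [Fintype A] [MeasurableSpace A] [MeasurableSingletonClass A]
    {P : Measure (ℕ → A)} {Q : A → A → ℝ} (hQpos : ∀ x y, 0 < Q x y) (hM : MarkovProp P Q)
    (x : ℕ → A) (k : ℕ) (f : (ℕ → A) → ℝ≥0∞) (hf : DepLe k f) (n : ℕ) :
    ∫⁻ ω, f ω * Set.indicator (winSet x k (n + 1)) 1 ω ∂P
      = ENNReal.ofReal (∏ i ∈ Finset.range n, Q (x (i + 1)) (x (i + 1 + 1))) *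
        ∫⁻ ω, f ω * ENNReal.ofReal (Q (ω k) (x 1)) ∂P := by
  classical
  induction n with
  | zero =>
    simp only [Finset.range_zero, Finset.prod_empty, ENNReal.ofReal_one, one_mul]
    rw [← hM k f hf (x 1)]
    have : winSet x k (0 + 1) = {ω | ω (k + 1) = x 1} := by
      ext ω
      constructor
      · intro h; exact h 1 le_rfl le_rfl
      · intro h i h1 h2
        obtain rfl : i = 1 := by omega
        exact h
    rw [this]
  | succ n ih =>
    have hdep : DepLe (k + (n + 1)) (fun ω => f ω * Set.indicator (winSet x k (n + 1)) 1 ω) := by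
      intro y z h
      have h1 := hf y z fun i hi => h i (by omega)
      have h2 := winSet_indicator_dep x k (n + 1) y z h
      simp only [h1, h2]
    have h := hM _ _ hdep (x (n + 1 + 1))
    have h1 : ∀ ω : ℕ → A, f ω * Set.indicator (winSet x k (n + 1)) 1 ω *
        Set.indicator {ω | ω (k + (n + 1) + 1) = x (n + 1 + 1)} 1 ω
        = f ω * Set.indicator (winSet x k (n + 1 + 1)) 1 ω := by
      intro ω
      rw [mul_assoc]
      congr 1
      have : winSet x k (n + 1 + 1)
          = winSet x k (n + 1) ∩ {ω | ω (k + (n + 1) + 1) = x (n + 1 + 1)} := by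
        ext ω
        constructor
        · intro h
          exact ⟨fun i hi hi' => h i hi (by omega), h (n + 1 + 1) (by omega) le_rfl⟩
        · rintro ⟨h1, h2⟩ i hi hi'
          rcases Nat.lt_or_ge i (n + 1 + 1) with h | h
          · exact h1 i hi (by omega)
          · obtain rfl : i = n + 1 + 1 := by omega
            exact h2
      rw [this, Set.inter_indicator_one]
      rfl
    have h2 : ∀ ω : ℕ → A, f ω * Set.indicator (winSet x k (n + 1)) 1 ω *
        ENNReal.ofReal (Q (ω (k + (n + 1))) (x (n + 1 + 1)))
        = ENNReal.ofReal (Q (x (n + 1)) (x (n + 1 + 1))) *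
          (f ω * Set.indicator (winSet x k (n + 1)) 1 ω) := by
      intro ω
      by_cases hω : ω ∈ winSet x k (n + 1)
      · rw [hω (n + 1) (by omega) le_rfl, mul_comm]
      · simp [Set.indicator_of_notMem hω]
    simp only [h1, h2] at h
    rw [h, lintegral_const_mul _ (DepLe.measurable hdep), ih, ← mul_assoc,
      ← ENNReal.ofReal_mul (hQpos _ _).le, Finset.prod_range_succ, mul_comm (Q _ _)]

lemma trProd_pos {A : Type*} {Q : A → A → ℝ} (hQpos : ∀ x y, 0 < Q x y) (n : ℕ) (x : ℕ → A) :
    0 < trProd Q n x := Finset.prod_pos fun _ _ => hQpos _ _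

lemma trProd_le_one {A : Type*} {Q : A → A → ℝ} (hQpos : ∀ x y, 0 < Q x y)
    (hQ1 : ∀ x y, Q x y ≤ 1) (n : ℕ) (x : ℕ → A) :
    trProd Q n x ≤ 1 := Finset.prod_le_one (fun _ _ => (hQpos _ _).le) fun _ _ => hQ1 _ _

lemma le_trProd {A : Type*} {Q : A → A → ℝ} {δ : ℝ} (hδ : 0 < δ)
    (hQδ : ∀ x y, δ ≤ Q x y) (n : ℕ) (x : ℕ → A) :
    δ ^ n ≤ trProd Q n x := by
  have := Finset.prod_le_prod (s := Finset.range n) (f := fun _ => δ)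
    (g := fun i => Q (x i) (x (i + 1))) (fun _ _ => hδ.le) (fun _ _ => hQδ _ _)
  simpa [trProd] using this

lemma window_upper {A : Type*} [Fintype A] [MeasurableSpace A] [MeasurableSingletonClass A]
    {P : Measure (ℕ → A)} {Q : A → A → ℝ} (hQpos : ∀ x y, 0 < Q x y) (hM : MarkovProp P Q)
    {δ : ℝ} (hδ : 0 < δ) (hQδ : ∀ x y, δ ≤ Q x y) (hQ1 : ∀ x y, Q x y ≤ 1)
    (x : ℕ → A) (k : ℕ) (f : (ℕ → A) → ℝ≥0∞) (hf : DepLe k f) (n : ℕ) (hn : 1 ≤ n) :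
    ∫⁻ ω, f ω * Set.indicator (winSet x k n) 1 ω ∂P
      ≤ ENNReal.ofReal (δ⁻¹ * trProd Q n x) * ∫⁻ ω, f ω ∂P := by
  obtain ⟨m, rfl⟩ : ∃ m, n = m + 1 := ⟨n - 1, by omega⟩
  rw [window_exact hQpos hM x k f hf m]
  set r := ∏ i ∈ Finset.range m, Q (x (i + 1)) (x (i + 1 + 1)) with hr
  have hr0 : 0 < r := Finset.prod_pos fun _ _ => hQpos _ _
  have h1 : trProd Q (m + 1) x = r * Q (x 0) (x 1) := by
    rw [trProd, Finset.prod_range_succ']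
  refine mul_le_mul' (ENNReal.ofReal_le_ofReal ?_) (lintegral_mono fun ω => ?_)
  · rw [h1]
    have : 1 ≤ δ⁻¹ * Q (x 0) (x 1) := by
      rw [← inv_mul_cancel₀ hδ.ne']
      exact mul_le_mul_of_nonneg_left (hQδ _ _) (inv_nonneg.2 hδ.le)
    nlinarith
  · refine mul_le_of_le_one_right' ?_
    rw [← ENNReal.ofReal_one]
    exact ENNReal.ofReal_le_ofReal (hQ1 _ _)

lemma window_lower {A : Type*} [Fintype A] [MeasurableSpace A] [MeasurableSingletonClass A]
    {P : Measure (ℕ → A)} {Q : A → A → ℝ} (hQpos : ∀ x y, 0 < Q x y) (hM : MarkovProp P Q)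
    {δ : ℝ} (hδ : 0 < δ) (hQδ : ∀ x y, δ ≤ Q x y) (hQ1 : ∀ x y, Q x y ≤ 1)
    (x : ℕ → A) (k : ℕ) (f : (ℕ → A) → ℝ≥0∞) (hf : DepLe k f) (n : ℕ) (hn : 1 ≤ n) :
    ENNReal.ofReal (δ * trProd Q n x) * ∫⁻ ω, f ω ∂P ≤
    ∫⁻ ω, f ω * Set.indicator (winSet x k n) 1 ω ∂P := by
  obtain ⟨m, rfl⟩ : ∃ m, n = m + 1 := ⟨n - 1, by omega⟩
  rw [window_exact hQpos hM x k f hf m]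
  set r := ∏ i ∈ Finset.range m, Q (x (i + 1)) (x (i + 1 + 1)) with hr
  have hr0 : 0 < r := Finset.prod_pos fun _ _ => hQpos _ _
  have h1 : trProd Q (m + 1) x = r * Q (x 0) (x 1) := by
    rw [trProd, Finset.prod_range_succ']
  have h2 : ENNReal.ofReal (δ * trProd Q (m + 1) x) ≤ ENNReal.ofReal r * ENNReal.ofReal δ := by
    rw [← ENNReal.ofReal_mul hr0.le, h1]
    refine ENNReal.ofReal_le_ofReal ?_
    have := mul_le_mul_of_nonneg_left (hQ1 (x 0) (x 1)) (mul_pos hr0 hδ).le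
    nlinarith
  calc _ ≤ ENNReal.ofReal r * ENNReal.ofReal δ * ∫⁻ ω, f ω ∂P := by gcongr
    _ = ENNReal.ofReal r * ∫⁻ ω, f ω * ENNReal.ofReal δ ∂P := by
        rw [lintegral_mul_const _ (DepLe.measurable hf)]; ring
    _ ≤ _ := by
        gcongr with ω
        exact hQδ _ _

/-- no occurrence in the first `m` disjoint windows -/
def noWin {A : Type*} (x : ℕ → A) (n m : ℕ) : Set (ℕ → A) :=
  {ω | ∀ j, 1 ≤ j → j ≤ m → ω ∉ winSet x (j * n) n}

lemma noWin_measurable {A : Type*} [Fintype A] [MeasurableSpace A] [MeasurableSingletonClass A]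
    (x : ℕ → A) (n m : ℕ) : MeasurableSet (noWin x n m) := by
  simp only [noWin, Set.ofPred_forall]
  exact MeasurableSet.iInter fun j => MeasurableSet.iInter fun _ => MeasurableSet.iInter fun _ =>
    (winSet_measurable x (j * n) n).compl

lemma noWin_dep {A : Type*} (x : ℕ → A) (n m : ℕ) :
    DepLe ((m + 1) * n) (fun ω => Set.indicator (noWin x n m) (1 : (ℕ → A) → ℝ≥0∞) ω) := by
  classical
  intro y z h
  have : y ∈ noWin x n m ↔ z ∈ noWin x n m := by
    simp only [noWin, winSet, Set.mem_ofPred_eq]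
    refine forall_congr' fun j => forall_congr' fun _ => forall_congr' fun hj => not_congr ?_
    refine forall_congr' fun i => forall_congr' fun _ => forall_congr' fun hi => ?_
    rw [h (j * n + i) (by nlinarith)]
  simp only [Set.indicator_apply, this, Pi.one_apply]

lemma noWin_bound {A : Type*} [Fintype A] [MeasurableSpace A] [MeasurableSingletonClass A]
    {P : Measure (ℕ → A)} [IsProbabilityMeasure P]
    {Q : A → A → ℝ} (hQpos : ∀ x y, 0 < Q x y) (hM : MarkovProp P Q)
    {δ : ℝ} (hδ : 0 < δ) (hδ1 : δ ≤ 1) (hQδ : ∀ x y, δ ≤ Q x y) (hQ1 : ∀ x y, Q x y ≤ 1)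
    (x : ℕ → A) (n : ℕ) (hn : 1 ≤ n) (m : ℕ) :
    P (noWin x n m) ≤ ENNReal.ofReal ((1 - δ * trProd Q n x) ^ m) := by
  have hR0 := trProd_pos hQpos n x
  have hR1 := trProd_le_one hQpos hQ1 n x
  have hle : δ * trProd Q n x ≤ 1 := mul_le_one₀ hδ1 hR0.le hR1
  induction m with
  | zero => simpa using prob_le_one
  | succ m ih =>
    have h := window_lower hQpos hM hδ hQδ hQ1 x ((m + 1) * n) _ (noWin_dep x n m) n hn
    rw [lintegral_indicator_one (noWin_measurable x n m)] at h
    have h1 : ∀ ω : ℕ → A, Set.indicator (noWin x n m) (1 : (ℕ → A) → ℝ≥0∞) ω *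
        Set.indicator (winSet x ((m + 1) * n) n) 1 ω
        = Set.indicator (noWin x n m ∩ winSet x ((m + 1) * n) n) 1 ω := by
      intro ω
      rw [Set.inter_indicator_one]; rfl
    simp only [h1] at h
    rw [lintegral_indicator_one
      ((noWin_measurable x n m).inter (winSet_measurable x _ n))] at h
    have h2 : noWin x n (m + 1) = noWin x n m \ winSet x ((m + 1) * n) n := by
      ext ω
      constructor
      · intro h
        exact ⟨fun j h1 h2 => h j h1 (by omega), h (m + 1) (by omega) le_rfl⟩
      · rintro ⟨h1, h2⟩ j hj hj'
        rcases Nat.lt_or_ge j (m + 1) with h | h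
        · exact h1 j hj (by omega)
        · obtain rfl : j = m + 1 := by omega
          exact h2
    have h3 := measure_sdiff_add_inter (μ := P) (noWin x n m) (winSet_measurable x ((m + 1) * n) n)
    rw [← h2] at h3
    set a := P (noWin x n (m + 1)) with ha
    set b := P (noWin x n m) with hb
    set c := P (noWin x n m ∩ winSet x ((m + 1) * n) n) with hc
    have hbt : b ≠ ∞ := measure_ne_top _ _
    have hat : a ≠ ∞ := measure_ne_top _ _
    have hct : c ≠ ∞ := measure_ne_top _ _
    have h4 : a.toReal + c.toReal = b.toReal := by
      rw [← ENNReal.toReal_add hat hct, h3]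
    have h5 : δ * trProd Q n x * b.toReal ≤ c.toReal := by
      have := ENNReal.toReal_mono hct h
      rwa [ENNReal.toReal_mul, ENNReal.toReal_ofReal (by positivity)] at this
    have h6 : b.toReal ≤ (1 - δ * trProd Q n x) ^ m :=
      ENNReal.toReal_le_of_le_ofReal (pow_nonneg (by linarith) _) ih
    rw [← ENNReal.ofReal_toReal hat]
    refine ENNReal.ofReal_le_ofReal ?_
    rw [pow_succ]
    have : b.toReal * (1 - δ * trProd Q n x) ≤ (1 - δ * trProd Q n x) ^ m * (1 - δ * trProd Q n x) :=
      mul_le_mul_of_nonneg_right h6 (by linarith)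
    nlinarith

lemma waitingTime_le {A : Type*} (n : ℕ) (x y : ℕ → A) (k : ℕ) (hk : 1 ≤ k)
    (h : y ∈ winSet x k n) : waitingTime n x y ≤ k := Nat.sInf_le ⟨hk, h⟩

lemma waitingTime_mem {A : Type*} (n : ℕ) (x y : ℕ → A) (h : waitingTime n x y ≠ 0) :
    y ∈ winSet x (waitingTime n x y) n := by
  have : {k | 1 ≤ k ∧ ∀ i, 1 ≤ i → i ≤ n → y (k + i) = x i}.Nonempty := by
    by_contra hne
    rw [Set.not_nonempty_iff_eq_empty] at hne
    exact h (by rw [waitingTime, hne, Nat.sInf_empty])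
  exact (Nat.sInf_mem this).2

lemma waitingTime_zero {A : Type*} (n : ℕ) (x y : ℕ → A) (h : waitingTime n x y = 0)
    (k : ℕ) (hk : 1 ≤ k) : y ∉ winSet x k n := by
  intro hy
  have hm := Nat.sInf_mem (s := {k | 1 ≤ k ∧ ∀ i, 1 ≤ i → i ≤ n → y (k + i) = x i}) ⟨k, hk, hy⟩
  have h1 := hm.1
  rw [waitingTime] at h
  omega

lemma waitingTime_measurable {A : Type*} [Fintype A] [MeasurableSpace A]
    [MeasurableSingletonClass A] (n : ℕ) :
    Measurable (fun z : (ℕ → A) × (ℕ → A) => waitingTime n z.1 z.2) := by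
  have hE : ∀ k, MeasurableSet {z : (ℕ → A) × (ℕ → A) | z.2 ∈ winSet z.1 k n} := by
    intro k
    have : {z : (ℕ → A) × (ℕ → A) | z.2 ∈ winSet z.1 k n}
        = ⋂ i : ℕ, ⋂ _ : 1 ≤ i, ⋂ _ : i ≤ n, {z | z.2 (k + i) = z.1 i} := by
      ext z; simp [winSet]
    rw [this]
    refine MeasurableSet.iInter fun i => MeasurableSet.iInter fun _ =>
      MeasurableSet.iInter fun _ => ?_
    exact measurableSet_eq_fun ((measurable_pi_apply _).comp measurable_snd)
      ((measurable_pi_apply _).comp measurable_fst)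
  refine measurable_to_countable' fun k => ?_
  rcases Nat.eq_zero_or_pos k with rfl | hk
  · have : (fun z : (ℕ → A) × (ℕ → A) => waitingTime n z.1 z.2) ⁻¹' {0}
        = ⋂ k : ℕ, ⋂ _ : 1 ≤ k, {z : (ℕ → A) × (ℕ → A) | z.2 ∈ winSet z.1 k n}ᶜ := by
      ext z
      simp only [Set.mem_preimage, Set.mem_singleton_iff, Set.mem_iInter, Set.mem_compl_iff,
        Set.mem_ofPred_eq]
      constructor
      · intro h k hk; exact waitingTime_zero n _ _ h k hk
      · intro h
        by_contra h0
        exact h _ (Nat.one_le_iff_ne_zero.2 h0) (waitingTime_mem n _ _ h0)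
    rw [this]
    exact MeasurableSet.iInter fun k => MeasurableSet.iInter fun _ => (hE k).compl
  · have : (fun z : (ℕ → A) × (ℕ → A) => waitingTime n z.1 z.2) ⁻¹' {k}
        = {z : (ℕ → A) × (ℕ → A) | z.2 ∈ winSet z.1 k n} ∩
          ⋂ j : ℕ, ⋂ _ : 1 ≤ j, ⋂ _ : j < k,
            {z : (ℕ → A) × (ℕ → A) | z.2 ∈ winSet z.1 j n}ᶜ := by
      ext z
      simp only [Set.mem_preimage, Set.mem_singleton_iff, Set.mem_iInter, Set.mem_compl_iff,
        Set.mem_inter_iff, Set.mem_ofPred_eq]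
      constructor
      · rintro rfl
        refine ⟨waitingTime_mem n _ _ (by omega), fun j hj hjk hmem => ?_⟩
        have := waitingTime_le n _ _ j hj hmem
        omega
      · rintro ⟨h1, h2⟩
        have h3 := waitingTime_le n _ _ k hk h1
        have h4 : waitingTime n z.1 z.2 ≠ 0 := fun h0 => waitingTime_zero n _ _ h0 k hk h1
        by_contra hne
        exact h2 _ (Nat.one_le_iff_ne_zero.2 h4) (by omega) (waitingTime_mem n _ _ h4)
    rw [this]
    exact (hE k).inter (MeasurableSet.iInter fun k => MeasurableSet.iInter fun _ =>
      MeasurableSet.iInter fun _ => (hE k).compl)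

lemma waitingTime_measurable' {A : Type*} [Fintype A] [MeasurableSpace A]
    [MeasurableSingletonClass A] (n : ℕ) (x : ℕ → A) :
    Measurable (fun y : ℕ → A => waitingTime n x y) :=
  (waitingTime_measurable n).comp (measurable_const.prodMk measurable_id)

lemma lintegral_waiting {A : Type*} [Fintype A] [MeasurableSpace A] [MeasurableSingletonClass A]
    {P : Measure (ℕ → A)} [IsProbabilityMeasure P]
    {Q : A → A → ℝ} (hQpos : ∀ x y, 0 < Q x y) (hM : MarkovProp P Q)
    {δ : ℝ} (hδ : 0 < δ) (hδ1 : δ ≤ 1) (hQδ : ∀ x y, δ ≤ Q x y) (hQ1 : ∀ x y, Q x y ≤ 1)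
    (x : ℕ → A) (n : ℕ) (hn : 1 ≤ n) :
    ∫⁻ y, ENNReal.ofReal (waitingTime n x y : ℝ) ∂P
      ≤ ENNReal.ofReal (n * (δ * trProd Q n x)⁻¹) := by
  classical
  have hR0 := trProd_pos hQpos n x
  have hR1 := trProd_le_one hQpos hQ1 n x
  have hle : δ * trProd Q n x ≤ 1 := mul_le_one₀ hδ1 hR0.le hR1
  have hdR : 0 < δ * trProd Q n x := mul_pos hδ hR0
  have hpt : ∀ y : ℕ → A, ENNReal.ofReal (waitingTime n x y : ℝ)
      ≤ ∑' m : ℕ, (n : ℝ≥0∞) * Set.indicator (noWin x n m) 1 y := by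
    intro y
    have hN : ∃ N : ℕ, waitingTime n x y ≤ n * N ∧ ∀ m < N, y ∈ noWin x n m := by
      by_cases h : ∃ j, 1 ≤ j ∧ y ∈ winSet x (j * n) n
      · refine ⟨Nat.find h, ?_, ?_⟩
        · have hs := Nat.find_spec h
          rw [mul_comm]
          exact waitingTime_le n x y _ (Nat.mul_pos hs.1 hn) hs.2
        · intro m hm j hj hjm hmem
          exact Nat.find_min h (lt_of_le_of_lt hjm hm) ⟨hj, hmem⟩
      · push Not at h
        exact ⟨waitingTime n x y, Nat.le_mul_of_pos_left _ hn, fun m _ j hj _ => h j hj⟩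
    obtain ⟨N, hN1, hN2⟩ := hN
    calc ENNReal.ofReal (waitingTime n x y : ℝ) = ((waitingTime n x y : ℕ) : ℝ≥0∞) :=
          ENNReal.ofReal_natCast _
      _ ≤ ((n * N : ℕ) : ℝ≥0∞) := by exact_mod_cast hN1
      _ = ∑ m ∈ Finset.range N, (n : ℝ≥0∞) * Set.indicator (noWin x n m) 1 y := by
          rw [Finset.sum_congr rfl fun m hm => by
            rw [Set.indicator_of_mem (hN2 m (Finset.mem_range.1 hm)), Pi.one_apply, mul_one]]
          simp [mul_comm]
      _ ≤ _ := ENNReal.sum_le_tsum _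
  calc ∫⁻ y, ENNReal.ofReal (waitingTime n x y : ℝ) ∂P
      ≤ ∫⁻ y, ∑' m : ℕ, (n : ℝ≥0∞) * Set.indicator (noWin x n m) 1 y ∂P := lintegral_mono hpt
    _ = ∑' m : ℕ, (n : ℝ≥0∞) * P (noWin x n m) := by
        rw [lintegral_tsum fun m =>
          ((measurable_one.indicator (noWin_measurable x n m)).const_mul _).aemeasurable]
        refine tsum_congr fun m => ?_
        rw [lintegral_const_mul _ (measurable_one.indicator (noWin_measurable x n m)),
          lintegral_indicator_one (noWin_measurable x n m)]
    _ ≤ ∑' m : ℕ, (n : ℝ≥0∞) * ENNReal.ofReal ((1 - δ * trProd Q n x) ^ m) := by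
        refine ENNReal.tsum_le_tsum fun m => ?_
        gcongr
        exact noWin_bound hQpos hM hδ hδ1 hQδ hQ1 x n hn m
    _ = ENNReal.ofReal (n * (δ * trProd Q n x)⁻¹) := by
        rw [ENNReal.tsum_mul_left, ← ENNReal.ofReal_tsum_of_nonneg
          (fun m => pow_nonneg (by linarith) _)
          (summable_geometric_of_lt_one (by linarith) (by linarith)),
          tsum_geometric_of_lt_one (by linarith) (by linarith),
          ENNReal.ofReal_mul (by positivity), ENNReal.ofReal_natCast]
        congr 3
        ring

lemma waiting_pos_ae {A : Type*} [Fintype A] [MeasurableSpace A] [MeasurableSingletonClass A]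
    {P : Measure (ℕ → A)} [IsProbabilityMeasure P]
    {Q : A → A → ℝ} (hQpos : ∀ x y, 0 < Q x y) (hM : MarkovProp P Q)
    {δ : ℝ} (hδ : 0 < δ) (hδ1 : δ ≤ 1) (hQδ : ∀ x y, δ ≤ Q x y) (hQ1 : ∀ x y, Q x y ≤ 1)
    (x : ℕ → A) (n : ℕ) (hn : 1 ≤ n) :
    ∀ᵐ y ∂P, 0 < waitingTime n x y := by
  have hR0 := trProd_pos hQpos n x
  have hR1 := trProd_le_one hQpos hQ1 n x
  have hle : δ * trProd Q n x ≤ 1 := mul_le_one₀ hδ1 hR0.le hR1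
  have hdR : 0 < δ * trProd Q n x := mul_pos hδ hR0
  rw [ae_iff]
  have h1 : ∀ m, P {y | ¬ 0 < waitingTime n x y} ≤ ENNReal.ofReal ((1 - δ * trProd Q n x) ^ m) := by
    intro m
    refine (measure_mono ?_).trans (noWin_bound hQpos hM hδ hδ1 hQδ hQ1 x n hn m)
    intro y hy j hj _
    exact waitingTime_zero n x y (by simpa using hy) _ (Nat.mul_pos hj hn)
  have h2 : Tendsto (fun m : ℕ => ENNReal.ofReal ((1 - δ * trProd Q n x) ^ m)) atTop (nhds 0) := by
    rw [← ENNReal.ofReal_zero]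
    exact ENNReal.tendsto_ofReal (tendsto_pow_atTop_nhds_zero_of_lt_one (by linarith) (by linarith))
  exact le_antisymm (ge_of_tendsto' h2 h1) (zero_le)

lemma lintegral_inv_waiting {A : Type*} [Fintype A] [MeasurableSpace A]
    [MeasurableSingletonClass A]
    {P : Measure (ℕ → A)} [IsProbabilityMeasure P]
    {Q : A → A → ℝ} (hQpos : ∀ x y, 0 < Q x y) (hM : MarkovProp P Q)
    {δ : ℝ} (hδ : 0 < δ) (hδ1 : δ ≤ 1) (hQδ : ∀ x y, δ ≤ Q x y) (hQ1 : ∀ x y, Q x y ≤ 1)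
    (x : ℕ → A) (n : ℕ) (hn : 1 ≤ n) :
    ∫⁻ y, ENNReal.ofReal (waitingTime n x y : ℝ)⁻¹ ∂P
      ≤ ENNReal.ofReal ((δ⁻¹ * (2 + n * Real.log δ⁻¹) + 1) * trProd Q n x) := by
  classical
  set R := trProd Q n x with hR
  have hR0 : 0 < R := trProd_pos hQpos n x
  have hR1 : R ≤ 1 := trProd_le_one hQpos hQ1 n x
  have hRδ : δ ^ n ≤ R := le_trProd hδ hQδ n x
  set K := ⌈R⁻¹⌉₊ with hK
  have hK1 : R⁻¹ ≤ K := Nat.le_ceil _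
  have hKone : (1:ℝ) ≤ K := (one_le_inv_iff₀.2 ⟨hR0, hR1⟩).trans hK1
  have hK2 : (K : ℝ) ≤ 2 * R⁻¹ := by
    have := (Nat.ceil_lt_add_one (inv_nonneg.2 hR0.le)).le
    have h1 : 1 ≤ R⁻¹ := one_le_inv_iff₀.2 ⟨hR0, hR1⟩
    linarith
  have hpt : ∀ y : ℕ → A, ENNReal.ofReal (waitingTime n x y : ℝ)⁻¹
      ≤ ∑ k ∈ Finset.range K, ENNReal.ofReal ((k + 1 : ℕ) : ℝ)⁻¹ *
          Set.indicator (winSet x (k + 1) n) 1 y + ENNReal.ofReal (K : ℝ)⁻¹ := by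
    intro y
    by_cases h0 : waitingTime n x y = 0
    · simp [h0]
    by_cases hWK : waitingTime n x y ≤ K
    · refine le_trans ?_ le_self_add
      have hmem : waitingTime n x y - 1 ∈ Finset.range K := by
        rw [Finset.mem_range]; omega
      refine le_trans ?_ (Finset.single_le_sum (fun _ _ => zero_le) hmem)
      have : waitingTime n x y - 1 + 1 = waitingTime n x y := by omega
      rw [this, Set.indicator_of_mem (waitingTime_mem n x y h0), Pi.one_apply, mul_one]
    · refine le_trans ?_ le_add_self
      refine ENNReal.ofReal_le_ofReal ?_
      have : (K : ℝ) ≤ waitingTime n x y := by exact_mod_cast (by omega : K ≤ waitingTime n x y)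
      exact inv_anti₀ (by linarith) this
  have hlog : (harmonic K : ℝ) ≤ 2 + n * Real.log δ⁻¹ := by
    refine (harmonic_le_one_add_log K).trans ?_
    have h1 : Real.log K ≤ Real.log (2 * R⁻¹) := Real.log_le_log (by linarith) hK2
    rw [Real.log_mul (by norm_num) (inv_pos.2 hR0).ne'] at h1
    have h2 : Real.log R⁻¹ ≤ n * Real.log δ⁻¹ := by
      rw [← Real.log_pow, inv_pow]
      exact Real.log_le_log (inv_pos.2 hR0) (inv_anti₀ (pow_pos hδ n) hRδ)
    have h3 : Real.log 2 ≤ 1 := by linarith [Real.log_two_lt_d9]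
    linarith
  have hwin : ∀ k, P (winSet x (k + 1) n) ≤ ENNReal.ofReal (δ⁻¹ * R) := by
    intro k
    have := window_upper hQpos hM hδ hQδ hQ1 x (k + 1) (fun _ => 1) (fun _ _ _ => rfl) n hn
    simpa [lintegral_indicator_one (winSet_measurable x (k + 1) n)] using this
  calc ∫⁻ y, ENNReal.ofReal (waitingTime n x y : ℝ)⁻¹ ∂P
      ≤ ∫⁻ y, (∑ k ∈ Finset.range K, ENNReal.ofReal ((k + 1 : ℕ) : ℝ)⁻¹ *
          Set.indicator (winSet x (k + 1) n) 1 y + ENNReal.ofReal (K : ℝ)⁻¹) ∂P :=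
        lintegral_mono hpt
    _ = ∑ k ∈ Finset.range K, ENNReal.ofReal ((k + 1 : ℕ) : ℝ)⁻¹ * P (winSet x (k + 1) n)
          + ENNReal.ofReal (K : ℝ)⁻¹ := by
        rw [lintegral_add_right _ measurable_const, lintegral_finsetSum]
        · simp only [lintegral_const, measure_univ, mul_one]
          congr 1
          refine Finset.sum_congr rfl fun k _ => ?_
          rw [lintegral_const_mul _ (measurable_one.indicator (winSet_measurable x _ n)),
            lintegral_indicator_one (winSet_measurable x _ n)]
        · intro k _
          exact (measurable_one.indicator (winSet_measurable x _ n)).const_mul _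
    _ ≤ ∑ k ∈ Finset.range K, ENNReal.ofReal ((k + 1 : ℕ) : ℝ)⁻¹ * ENNReal.ofReal (δ⁻¹ * R)
          + ENNReal.ofReal R := by
        gcongr with k hk
        · exact hwin k
        · exact inv_le_of_inv_le₀ hR0 hK1
    _ = ENNReal.ofReal ((harmonic K : ℝ) * (δ⁻¹ * R) + R) := by
        rw [← Finset.sum_mul, ← ENNReal.ofReal_sum_of_nonneg (fun _ _ => by positivity),
          ← ENNReal.ofReal_mul (Finset.sum_nonneg fun _ _ => by positivity),
          ← ENNReal.ofReal_add (mul_nonneg (Finset.sum_nonneg fun _ _ => by positivity)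
            (by positivity)) hR0.le]
        congr 3
        simp [harmonic]
    _ ≤ _ := by
        refine ENNReal.ofReal_le_ofReal ?_
        have : (harmonic K : ℝ) * (δ⁻¹ * R) ≤ (2 + n * Real.log δ⁻¹) * (δ⁻¹ * R) :=
          mul_le_mul_of_nonneg_right hlog (by positivity)
        linarith

/-- Two sided moment bound for the normalized waiting time. -/
lemma moment_bounds {A : Type*} [Fintype A] [Nonempty A] [MeasurableSpace A]
    [MeasurableSingletonClass A]
    {P : Measure (ℕ → A)} [IsProbabilityMeasure P]
    {Q : A → A → ℝ} (hQpos : ∀ x y, 0 < Q x y) (hM : MarkovProp P Q)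
    (hQ1 : ∀ x y, Q x y ≤ 1) :
    ∃ C : ℝ, 1 ≤ C ∧ ∀ n : ℕ, 1 ≤ n → ∀ x : ℕ → A, ∀ s : ℝ, -1 ≤ s → s ≤ 1 →
      ∫⁻ y, ENNReal.ofReal ((waitingTime n x y * trProd Q n x : ℝ) ^ s) ∂P
        ≤ ENNReal.ofReal (C * n) ∧
      ENNReal.ofReal (C * n)⁻¹ ≤
        ∫⁻ y, ENNReal.ofReal ((waitingTime n x y * trProd Q n x : ℝ) ^ s) ∂P := by
  obtain ⟨z, -, hz⟩ := Finset.exists_min_image (Finset.univ : Finset (A × A))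
    (fun z => Q z.1 z.2) Finset.univ_nonempty
  set δ := Q z.1 z.2 with hδdef
  have hδ : 0 < δ := hQpos _ _
  have hδ1 : δ ≤ 1 := hQ1 _ _
  have hQδ : ∀ x y, δ ≤ Q x y := fun x y => hz (x, y) (Finset.mem_univ _)
  have hlogδ : 0 ≤ Real.log δ⁻¹ := Real.log_nonneg (one_le_inv_iff₀.2 ⟨hδ, hδ1⟩)
  have hδi : 0 < δ⁻¹ := inv_pos.2 hδ
  set C : ℝ := 2 + δ⁻¹ + δ⁻¹ * (2 + Real.log δ⁻¹) with hC
  have hC1 : 1 ≤ C := by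
    have : 0 ≤ δ⁻¹ * (2 + Real.log δ⁻¹) := by positivity
    linarith
  refine ⟨C, hC1, ?_⟩
  intro n hn x
  set R := trProd Q n x with hR
  have hR0 : 0 < R := trProd_pos hQpos n x
  have hn' : (1:ℝ) ≤ n := by exact_mod_cast hn
  have hmeas : ∀ s : ℝ, Measurable
      (fun y : ℕ → A => ENNReal.ofReal ((waitingTime n x y * R : ℝ) ^ s)) := by
    intro s
    have h1 : Measurable (fun y : ℕ → A => (waitingTime n x y : ℝ)) :=
      (Measurable.of_discrete (f := fun k : ℕ => (k : ℝ))).comp (waitingTime_measurable' n x)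
    exact ((h1.mul_const R).pow_const s).ennreal_ofReal
  have hmeasW : Measurable (fun y : ℕ → A => (waitingTime n x y : ℝ)) :=
    (Measurable.of_discrete (f := fun k : ℕ => (k : ℝ))).comp (waitingTime_measurable' n x)
  have hpos := waiting_pos_ae hQpos hM hδ hδ1 hQδ hQ1 x n hn
  have hup : ∀ s : ℝ, -1 ≤ s → s ≤ 1 →
      ∫⁻ y, ENNReal.ofReal ((waitingTime n x y * R : ℝ) ^ s) ∂P ≤ ENNReal.ofReal (C * n) := by
    intro s hs1 hs2
    have hpt : ∀ᵐ y ∂P, ENNReal.ofReal ((waitingTime n x y * R : ℝ) ^ s) ≤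
        1 + ENNReal.ofReal R * ENNReal.ofReal (waitingTime n x y : ℝ)
          + ENNReal.ofReal R⁻¹ * ENNReal.ofReal (waitingTime n x y : ℝ)⁻¹ := by
      filter_upwards [hpos] with y hy
      have hW : (0:ℝ) < waitingTime n x y := by exact_mod_cast hy
      rw [← ENNReal.ofReal_mul hR0.le, ← ENNReal.ofReal_mul (inv_nonneg.2 hR0.le),
        ← ENNReal.ofReal_one, ← ENNReal.ofReal_add zero_le_one (by positivity),
        ← ENNReal.ofReal_add (by positivity) (by positivity)]
      refine ENNReal.ofReal_le_ofReal ?_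
      have hWR : 0 < (waitingTime n x y : ℝ) * R := mul_pos hW hR0
      have e1 : R * (waitingTime n x y : ℝ) = (waitingTime n x y : ℝ) * R := mul_comm _ _
      have e2 : R⁻¹ * (waitingTime n x y : ℝ)⁻¹ = ((waitingTime n x y : ℝ) * R)⁻¹ := by
        rw [mul_inv, mul_comm]
      rw [e1, e2]
      have hi := inv_pos.2 hWR
      rcases le_total 1 ((waitingTime n x y : ℝ) * R) with h | h
      · have := Real.rpow_le_rpow_of_exponent_le h hs2
        rw [Real.rpow_one] at this
        linarith
      · have := Real.rpow_le_rpow_of_exponent_ge hWR h hs1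
        rw [Real.rpow_neg_one] at this
        linarith
    refine (lintegral_mono_ae hpt).trans ?_
    rw [lintegral_add_right _ (by fun_prop), lintegral_add_right _ (by fun_prop),
      lintegral_const_mul _ (by fun_prop), lintegral_const_mul _ (by fun_prop)]
    have h1 := lintegral_waiting hQpos hM hδ hδ1 hQδ hQ1 x n hn
    have h2 := lintegral_inv_waiting hQpos hM hδ hδ1 hQδ hQ1 x n hn
    rw [← hR] at h1 h2
    calc _ ≤ 1 + ENNReal.ofReal R * ENNReal.ofReal (n * (δ * R)⁻¹)
          + ENNReal.ofReal R⁻¹ * ENNReal.ofReal ((δ⁻¹ * (2 + n * Real.log δ⁻¹) + 1) * R) := by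
          gcongr
          simp
      _ = ENNReal.ofReal (1 + n * δ⁻¹ + (δ⁻¹ * (2 + n * Real.log δ⁻¹) + 1)) := by
          rw [← ENNReal.ofReal_mul hR0.le, ← ENNReal.ofReal_mul (inv_nonneg.2 hR0.le),
            ← ENNReal.ofReal_one, ← ENNReal.ofReal_add zero_le_one (by positivity),
            ← ENNReal.ofReal_add (by positivity) (by positivity)]
          congr 1
          field_simp
      _ ≤ _ := by
          refine ENNReal.ofReal_le_ofReal ?_
          rw [hC]
          have : δ⁻¹ * 2 ≤ δ⁻¹ * 2 * n := le_mul_of_one_le_right (by positivity) hn'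
          nlinarith
  intro s hs1 hs2
  refine ⟨hup s hs1 hs2, ?_⟩
  set c : ℝ := (C * n)⁻¹ with hc
  have hCn : 0 < C * n := by positivity
  have hc0 : 0 < c := inv_pos.2 hCn
  have hpt : ∀ᵐ y ∂P, ENNReal.ofReal (2 * c) ≤
      ENNReal.ofReal ((waitingTime n x y * R : ℝ) ^ s) +
      ENNReal.ofReal (c ^ 2) * ENNReal.ofReal ((waitingTime n x y * R : ℝ) ^ (-s)) := by
    filter_upwards [hpos] with y hy
    have hW : (0:ℝ) < waitingTime n x y := by exact_mod_cast hy
    have hWR : 0 < (waitingTime n x y : ℝ) * R := mul_pos hW hR0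
    have ht := Real.rpow_pos_of_pos hWR s
    rw [Real.rpow_neg hWR.le]
    set t := ((waitingTime n x y : ℝ) * R) ^ s with htdef
    rw [← ENNReal.ofReal_mul (by positivity), ← ENNReal.ofReal_add ht.le (by positivity)]
    refine ENNReal.ofReal_le_ofReal ?_
    rw [← sub_nonneg]
    have : t + c ^ 2 * t⁻¹ - 2 * c = (t - c) ^ 2 / t := by field_simp; ring
    rw [this]; positivity
  have h1 := lintegral_mono_ae hpt
  rw [lintegral_const, measure_univ, mul_one, lintegral_add_left (hmeas s),
    lintegral_const_mul _ (hmeas (-s))] at h1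
  have h2 : ENNReal.ofReal (c ^ 2) *
      ∫⁻ y, ENNReal.ofReal ((waitingTime n x y * R : ℝ) ^ (-s)) ∂P ≤ ENNReal.ofReal c := by
    calc _ ≤ ENNReal.ofReal (c ^ 2) * ENNReal.ofReal (C * n) := by
          gcongr
          exact hup (-s) (by linarith) (by linarith)
      _ = _ := by
          rw [← ENNReal.ofReal_mul (by positivity)]
          congr 1
          rw [hc]; field_simp
  have h3 : ENNReal.ofReal c + ENNReal.ofReal c ≤
      ∫⁻ y, ENNReal.ofReal ((waitingTime n x y * R : ℝ) ^ s) ∂P + ENNReal.ofReal c := by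
    rw [← ENNReal.ofReal_add hc0.le hc0.le, ← two_mul]
    exact h1.trans (by gcongr)
  exact (ENNReal.add_le_add_iff_right ENNReal.ofReal_ne_top).1 h3

lemma growth_log (a : ℕ → ℝ) (c C l : ℝ) (hc : 0 < c) (hC : 0 < C) (hl : 0 < l)
    (h1 : ∀ n : ℕ, 1 ≤ n → c * ((n:ℝ) ^ 2)⁻¹ * l ^ n ≤ a n)
    (h2 : ∀ n : ℕ, 1 ≤ n → a n ≤ C * (n:ℝ) ^ 2 * l ^ n) :
    Tendsto (fun n : ℕ => Real.log (a n) / n) atTop (nhds (Real.log l)) := by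
  have hlogn : Tendsto (fun n : ℕ => Real.log n / n) atTop (nhds 0) :=
    (Real.isLittleO_log_id_atTop.tendsto_div_nhds_zero).comp tendsto_natCast_atTop_atTop
  have hcn : ∀ d : ℝ, Tendsto (fun n : ℕ => d / (n:ℝ)) atTop (nhds 0) := fun d =>
    tendsto_const_div_atTop_nhds_zero_nat d
  have hlo : Tendsto (fun n : ℕ => Real.log c / n - 2 * (Real.log n / n) + Real.log l) atTop
      (nhds (Real.log l)) := by
    have := ((hcn (Real.log c)).sub (hlogn.const_mul 2)).add_const (Real.log l)
    simpa using this
  have hhi : Tendsto (fun n : ℕ => Real.log C / n + 2 * (Real.log n / n) + Real.log l) atTop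
      (nhds (Real.log l)) := by
    have := ((hcn (Real.log C)).add (hlogn.const_mul 2)).add_const (Real.log l)
    simpa using this
  refine tendsto_of_tendsto_of_tendsto_of_le_of_le' hlo hhi ?_ ?_
  · filter_upwards [eventually_ge_atTop 1] with n hn
    have hn' : (0:ℝ) < n := by exact_mod_cast hn
    have := Real.log_le_log (by positivity) (h1 n hn)
    rw [Real.log_mul (by positivity) (by positivity), Real.log_mul (by positivity) (by positivity),
      Real.log_inv, Real.log_pow, Real.log_pow] at this
    rw [le_div_iff₀ hn']
    have e : (Real.log c / n - 2 * (Real.log n / n) + Real.log l) * n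
      = Real.log c + -((2:ℕ) * Real.log n) + n * Real.log l := by push_cast; field_simp; ring
    rw [e]; exact this
  · filter_upwards [eventually_ge_atTop 1] with n hn
    have hn' : (0:ℝ) < n := by exact_mod_cast hn
    have hpos : 0 < a n := lt_of_lt_of_le (by positivity) (h1 n hn)
    have := Real.log_le_log hpos (h2 n hn)
    rw [Real.log_mul (by positivity) (by positivity), Real.log_mul (by positivity) (by positivity),
      Real.log_pow, Real.log_pow] at this
    rw [div_le_iff₀ hn']
    have e : (Real.log C / n + 2 * (Real.log n / n) + Real.log l) * n
      = Real.log C + ((2:ℕ) * Real.log n) + n * Real.log l := by push_cast; field_simp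
    rw [e]; exact this

/-- the reduced partition function -/
noncomputable def Jn {A : Type*} [MeasurableSpace A] (P : Measure (ℕ → A)) (QX QY : A → A → ℝ)
    (n : ℕ) (p : ℝ) : ℝ≥0∞ :=
  ∫⁻ x, ENNReal.ofReal ((trProd QX n x / trProd QY n x) ^ p) ∂P

lemma trProd_dep {A : Type*} (Q : A → A → ℝ) (n : ℕ) : DepLe n (trProd Q n) := by
  intro y z h
  refine Finset.prod_congr rfl fun i hi => ?_
  have := Finset.mem_range.1 hi
  rw [h i (by omega), h (i + 1) (by omega)]

lemma Jn_growth {A : Type*} [Fintype A] [Nonempty A] [MeasurableSpace A]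
    [MeasurableSingletonClass A]
    {P : Measure (ℕ → A)} [IsProbabilityMeasure P] {QX QY : A → A → ℝ}
    (hX : ∀ x y, 0 < QX x y) (hY : ∀ x y, 0 < QY x y) (hM : MarkovProp P QX) (p l : ℝ)
    (hl : 0 < l) (v : A → ℝ) (hv : ∀ a, 0 < v a)
    (hMv : ∀ a, ∑ b, QX a b * (QX a b / QY a b) ^ p * v b = l * v a) :
    ∃ c C : ℝ, 0 < c ∧ 0 < C ∧ ∀ n, ENNReal.ofReal (c * l ^ n) ≤ Jn P QX QY n p ∧
      Jn P QX QY n p ≤ ENNReal.ofReal (C * l ^ n) := by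
  classical
  obtain ⟨a1, -, ha1⟩ := Finset.exists_min_image Finset.univ v Finset.univ_nonempty
  obtain ⟨a2, -, ha2⟩ := Finset.exists_max_image Finset.univ v Finset.univ_nonempty
  set g : A → A → ℝ := fun a b => (QX a b / QY a b) ^ p with hg
  have hgpos : ∀ a b, 0 < g a b := fun a b => Real.rpow_pos_of_pos (div_pos (hX a b) (hY a b)) p
  have hJ : ∀ n, Jn P QX QY n p = ∫⁻ x, ENNReal.ofReal (trProd g n x) ∂P := by
    intro n
    refine lintegral_congr fun x => ?_
    congr 1
    rw [trProd, trProd, trProd, ← Finset.prod_div_distrib,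
      ← Real.finsetProd_rpow _ _ (fun i _ => (div_pos (hX _ _) (hY _ _)).le)]
  set G : ℕ → ℝ≥0∞ := fun n => ∫⁻ x, ENNReal.ofReal (trProd g n x * v (x n)) ∂P with hG
  have hgt : ∀ n x, 0 < trProd g n x := fun n x => trProd_pos hgpos n x
  have hstep : ∀ n, G (n + 1) = ENNReal.ofReal l * G n := by
    intro n
    have hdep : ∀ b, DepLe n (fun x : ℕ → A => ENNReal.ofReal (trProd g n x * (g (x n) b * v b))) := by
      intro b y z h
      simp only [trProd_dep g n y z h, h n le_rfl]
    have hpt : ∀ x : ℕ → A, ENNReal.ofReal (trProd g (n + 1) x * v (x (n + 1)))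
        = ∑ b, ENNReal.ofReal (trProd g n x * (g (x n) b * v b)) *
          Set.indicator {x : ℕ → A | x (n + 1) = b} 1 x := by
      intro x
      rw [Finset.sum_eq_single (x (n + 1))]
      · rw [Set.indicator_of_mem (by rfl), Pi.one_apply, mul_one, trProd, Finset.prod_range_succ,
          mul_assoc]
        rfl
      · intro b _ hb
        have hnot : x ∉ {x : ℕ → A | x (n + 1) = b} := fun h => hb (Eq.symm h)
        rw [Set.indicator_of_notMem hnot, mul_zero]
      · simp
    have hmE : ∀ b, MeasurableSet {x : ℕ → A | x (n + 1) = b} := fun b =>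
      measurableSet_preimage (measurable_pi_apply (X := fun _ : ℕ => A) (n + 1))
        (measurableSet_singleton b)
    calc G (n + 1) = ∫⁻ x, ∑ b, ENNReal.ofReal (trProd g n x * (g (x n) b * v b)) *
          Set.indicator {x : ℕ → A | x (n + 1) = b} 1 x ∂P := lintegral_congr hpt
      _ = ∑ b, ∫⁻ x, ENNReal.ofReal (trProd g n x * (g (x n) b * v b)) *
          ENNReal.ofReal (QX (x n) b) ∂P := by
          rw [lintegral_finsetSum _ fun b _ => by
            exact (hdep b).measurable.mul (measurable_one.indicator (hmE b))]
          exact Finset.sum_congr rfl fun b _ => hM n _ (hdep b) b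
      _ = ∫⁻ x, ∑ b, ENNReal.ofReal (trProd g n x * (g (x n) b * v b)) *
          ENNReal.ofReal (QX (x n) b) ∂P := by
          rw [lintegral_finsetSum _ fun b _ => ?_]
          refine (hdep b).measurable.mul (DepLe.measurable (k := n) ?_)
          intro y z h
          simp only [h n le_rfl]
      _ = ∫⁻ x, ENNReal.ofReal l * ENNReal.ofReal (trProd g n x * v (x n)) ∂P := by
          refine lintegral_congr fun x => ?_
          have hnn : ∀ b, 0 ≤ trProd g n x * (g (x n) b * v b) := fun b =>
            mul_nonneg (hgt n x).le (mul_pos (hgpos _ _) (hv b)).le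
          simp only [← ENNReal.ofReal_mul (hnn _)]
          rw [← ENNReal.ofReal_sum_of_nonneg (fun b _ => mul_nonneg (hnn b) (hX _ _).le),
            ← ENNReal.ofReal_mul hl.le]
          congr 1
          rw [mul_left_comm, ← hMv (x n), Finset.mul_sum]
          exact Finset.sum_congr rfl fun b _ => by simp only [hg]; ring
      _ = _ := by
          rw [lintegral_const_mul]
          refine DepLe.measurable (k := n) ?_
          intro y z h
          simp only [trProd_dep g n y z h, h n le_rfl]
  have hGn : ∀ n, G n = ENNReal.ofReal (l ^ n) * G 0 := by
    intro n
    induction n with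
    | zero => simp
    | succ n ih => rw [hstep, ih, ← mul_assoc, ← ENNReal.ofReal_mul hl.le, pow_succ, mul_comm l]
  have hG0a : ENNReal.ofReal (v a1) ≤ G 0 := by
    calc ENNReal.ofReal (v a1) = ∫⁻ _ : ℕ → A, ENNReal.ofReal (v a1) ∂P := by simp
      _ ≤ _ := by
        refine lintegral_mono fun x => ENNReal.ofReal_le_ofReal ?_
        simpa [trProd] using ha1 (x 0) (Finset.mem_univ _)
  have hG0b : G 0 ≤ ENNReal.ofReal (v a2) := by
    calc G 0 ≤ ∫⁻ _ : ℕ → A, ENNReal.ofReal (v a2) ∂P := by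
          refine lintegral_mono fun x => ENNReal.ofReal_le_ofReal ?_
          simpa [trProd] using ha2 (x 0) (Finset.mem_univ _)
      _ = _ := by simp
  have hmeasJ : ∀ n, Measurable (fun x => ENNReal.ofReal (trProd g n x)) := fun n =>
    (trProd_dep g n).measurable.ennreal_ofReal
  have hv1 := hv a1
  have hv2 := hv a2
  refine ⟨(v a2)⁻¹ * v a1, (v a1)⁻¹ * v a2, by positivity, by positivity, fun n => ⟨?_, ?_⟩⟩
  · have h : G n ≤ ENNReal.ofReal (v a2) * Jn P QX QY n p := by
      rw [hJ, ← lintegral_const_mul _ (hmeasJ n)]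
      refine lintegral_mono fun x => ?_
      rw [← ENNReal.ofReal_mul hv2.le]
      refine ENNReal.ofReal_le_ofReal ?_
      rw [mul_comm]
      exact mul_le_mul_of_nonneg_right (ha2 _ (Finset.mem_univ _)) (hgt n x).le
    calc ENNReal.ofReal ((v a2)⁻¹ * v a1 * l ^ n)
        = ENNReal.ofReal (v a2)⁻¹ * (ENNReal.ofReal (l ^ n) * ENNReal.ofReal (v a1)) := by
          rw [← ENNReal.ofReal_mul (by positivity), ← ENNReal.ofReal_mul (by positivity)]
          congr 1; ring
      _ ≤ ENNReal.ofReal (v a2)⁻¹ * (ENNReal.ofReal (v a2) * Jn P QX QY n p) := by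
          rw [hGn] at h
          exact mul_le_mul_right (le_trans (mul_le_mul_right hG0a _) h) _
      _ = _ := by
          rw [← mul_assoc, ← ENNReal.ofReal_mul (by positivity), inv_mul_cancel₀ hv2.ne']
          simp
  · have h : ENNReal.ofReal (v a1) * Jn P QX QY n p ≤ G n := by
      rw [hJ, ← lintegral_const_mul _ (hmeasJ n)]
      refine lintegral_mono fun x => ?_
      rw [← ENNReal.ofReal_mul hv1.le]
      refine ENNReal.ofReal_le_ofReal ?_
      rw [mul_comm]
      exact mul_le_mul_of_nonneg_left (ha1 _ (Finset.mem_univ _)) (hgt n x).le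
    calc Jn P QX QY n p = ENNReal.ofReal (v a1)⁻¹ * (ENNReal.ofReal (v a1) * Jn P QX QY n p) := by
          rw [← mul_assoc, ← ENNReal.ofReal_mul (by positivity), inv_mul_cancel₀ hv1.ne']
          simp
      _ ≤ ENNReal.ofReal (v a1)⁻¹ * (ENNReal.ofReal (l ^ n) * ENNReal.ofReal (v a2)) := by
          rw [hGn] at h
          exact mul_le_mul_right (h.trans (mul_le_mul_right hG0b _)) _
      _ = _ := by
          rw [← ENNReal.ofReal_mul (by positivity), ← ENNReal.ofReal_mul (by positivity)]
          congr 1; ring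

lemma Jn_holder {A : Type*} [Fintype A] [MeasurableSpace A]
    [MeasurableSingletonClass A]
    {P : Measure (ℕ → A)} {QX QY : A → A → ℝ}
    (hX : ∀ x y, 0 < QX x y) (hY : ∀ x y, 0 < QY x y) (n : ℕ) (p q a b : ℝ)
    (ha : 0 ≤ a) (hb : 0 ≤ b) (hab : a + b = 1) :
    Jn P QX QY n (a * p + b * q) ≤ Jn P QX QY n p ^ a * Jn P QX QY n q ^ b := by
  have hm : ∀ s : ℝ, AEMeasurable
      (fun x => ENNReal.ofReal ((trProd QX n x / trProd QY n x) ^ s)) P := fun s =>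
    ((((trProd_dep QX n).measurable.div (trProd_dep QY n).measurable).pow_const
      s).ennreal_ofReal).aemeasurable
  have := ENNReal.lintegral_mul_norm_pow_le (hm p) (hm q) ha hb hab
  refine le_trans (le_of_eq ?_) this
  refine lintegral_congr fun x => ?_
  have h0 : 0 < trProd QX n x / trProd QY n x := div_pos (trProd_pos hX n x) (trProd_pos hY n x)
  rw [ENNReal.ofReal_rpow_of_pos (Real.rpow_pos_of_pos h0 _),
    ENNReal.ofReal_rpow_of_pos (Real.rpow_pos_of_pos h0 _),
    ← ENNReal.ofReal_mul (Real.rpow_nonneg (Real.rpow_nonneg h0.le _) _),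
    ← Real.rpow_mul h0.le, ← Real.rpow_mul h0.le, ← Real.rpow_add h0, mul_comm a, mul_comm b]

lemma sandwich {A : Type*} [Fintype A] [Nonempty A] [MeasurableSpace A]
    [MeasurableSingletonClass A]
    {P Pt : Measure (ℕ → A)} [IsProbabilityMeasure P] [IsProbabilityMeasure Pt]
    {QX QY : A → A → ℝ}
    (hX : ∀ x y, 0 < QX x y) (hY : ∀ x y, 0 < QY x y) (hX1 : ∀ x y, QX x y ≤ 1)
    (hY1 : ∀ x y, QY x y ≤ 1) (hM : MarkovProp P QX) (hMt : MarkovProp Pt QY) :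
    ∃ C : ℝ, 0 < C ∧ ∀ n : ℕ, 1 ≤ n → ∀ p : ℝ, -1 ≤ p → p ≤ 1 →
      ENNReal.ofReal (C⁻¹ * ((n:ℝ) ^ 2)⁻¹) * Jn P QX QY n p ≤
        ∫⁻ z, ENNReal.ofReal (((waitingTime n z.1.1 z.1.2 : ℝ) /
          (waitingTime n z.1.1 z.2 : ℝ)) ^ p) ∂((P.prod Pt).prod P) ∧
      ∫⁻ z, ENNReal.ofReal (((waitingTime n z.1.1 z.1.2 : ℝ) /
          (waitingTime n z.1.1 z.2 : ℝ)) ^ p) ∂((P.prod Pt).prod P)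
        ≤ ENNReal.ofReal (C * (n:ℝ) ^ 2) * Jn P QX QY n p := by
  obtain ⟨C1, hC1, hb1⟩ := moment_bounds hX hM hX1
  obtain ⟨C2, hC2, hb2⟩ := moment_bounds hY hMt hY1
  have hC1' : 0 < C1 := by linarith
  have hC2' : 0 < C2 := by linarith
  refine ⟨C1 * C2, by positivity, ?_⟩
  intro n hn p hp1 hp2
  have hn' : (0:ℝ) < n := by exact_mod_cast hn
  have hWm : Measurable (fun z : (ℕ → A) × (ℕ → A) => (waitingTime n z.1 z.2 : ℝ)) :=
    (Measurable.of_discrete (f := fun k : ℕ => (k : ℝ))).comp (waitingTime_measurable n)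
  have hW1 : Measurable (fun z : ((ℕ → A) × (ℕ → A)) × (ℕ → A) =>
      (waitingTime n z.1.1 z.1.2 : ℝ)) := hWm.comp measurable_fst
  have hW2 : Measurable (fun z : ((ℕ → A) × (ℕ → A)) × (ℕ → A) =>
      (waitingTime n z.1.1 z.2 : ℝ)) :=
    hWm.comp ((measurable_fst.comp measurable_fst).prodMk measurable_snd)
  have hRX : Measurable (trProd QX n) := (trProd_dep QX n).measurable
  have hRY : Measurable (trProd QY n) := (trProd_dep QY n).measurable
  have hWs : ∀ x : ℕ → A, Measurable (fun y : ℕ → A => (waitingTime n x y : ℝ)) := fun x =>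
    (Measurable.of_discrete (f := fun k : ℕ => (k : ℝ))).comp (waitingTime_measurable' n x)
  have hpt : ∀ x y z : ℕ → A, ENNReal.ofReal (((waitingTime n x y : ℝ) /
      (waitingTime n x z : ℝ)) ^ p)
      = ENNReal.ofReal ((trProd QX n x / trProd QY n x) ^ p) *
        ENNReal.ofReal ((waitingTime n x y * trProd QY n x : ℝ) ^ p) *
        ENNReal.ofReal ((waitingTime n x z * trProd QX n x : ℝ) ^ (-p)) := by
    intro x y z
    have h1 := trProd_pos hX n x
    have h2 := trProd_pos hY n x
    rw [← ENNReal.ofReal_mul (Real.rpow_nonneg (div_pos h1 h2).le _),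
      ← ENNReal.ofReal_mul (mul_nonneg (Real.rpow_nonneg (div_pos h1 h2).le _)
        (Real.rpow_nonneg (by positivity) _))]
    congr 1
    rw [Real.div_rpow (Nat.cast_nonneg _) (Nat.cast_nonneg _), Real.div_rpow h1.le h2.le,
      Real.mul_rpow (Nat.cast_nonneg _) h2.le, Real.mul_rpow (Nat.cast_nonneg _) h1.le,
      Real.rpow_neg (Nat.cast_nonneg _), Real.rpow_neg h1.le]
    have h3 := (Real.rpow_pos_of_pos h1 p).ne'
    have h4 := (Real.rpow_pos_of_pos h2 p).ne'
    field_simp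
  have hmain : ∫⁻ z, ENNReal.ofReal (((waitingTime n z.1.1 z.1.2 : ℝ) /
          (waitingTime n z.1.1 z.2 : ℝ)) ^ p) ∂((P.prod Pt).prod P)
      = ∫⁻ x, ENNReal.ofReal ((trProd QX n x / trProd QY n x) ^ p) *
        ((∫⁻ y, ENNReal.ofReal ((waitingTime n x y * trProd QY n x : ℝ) ^ p) ∂Pt) *
        ∫⁻ z, ENNReal.ofReal ((waitingTime n x z * trProd QX n x : ℝ) ^ (-p)) ∂P) ∂P := by
    have hmf : Measurable (fun z : ((ℕ → A) × (ℕ → A)) × (ℕ → A) =>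
        ENNReal.ofReal (((waitingTime n z.1.1 z.1.2 : ℝ) /
          (waitingTime n z.1.1 z.2 : ℝ)) ^ p)) := ((hW1.div hW2).pow_const p).ennreal_ofReal
    rw [lintegral_prod _ hmf.aemeasurable, lintegral_prod _ hmf.lintegral_prod_right'.aemeasurable]
    refine lintegral_congr fun x => ?_
    simp only [hpt]
    have e1 : ∀ y : ℕ → A, ∫⁻ z, ENNReal.ofReal ((trProd QX n x / trProd QY n x) ^ p) *
        ENNReal.ofReal ((waitingTime n x y * trProd QY n x : ℝ) ^ p) *
        ENNReal.ofReal ((waitingTime n x z * trProd QX n x : ℝ) ^ (-p)) ∂P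
        = ENNReal.ofReal ((trProd QX n x / trProd QY n x) ^ p) *
        ENNReal.ofReal ((waitingTime n x y * trProd QY n x : ℝ) ^ p) *
        ∫⁻ z, ENNReal.ofReal ((waitingTime n x z * trProd QX n x : ℝ) ^ (-p)) ∂P := fun y =>
      lintegral_const_mul _ ((((hWs x).mul_const _).pow_const _).ennreal_ofReal)
    simp only [e1]
    rw [lintegral_mul_const _ (((((hWs x).mul_const _).pow_const _).ennreal_ofReal).const_mul _),
      lintegral_const_mul _ ((((hWs x).mul_const _).pow_const _).ennreal_ofReal), mul_assoc]
  have hmJ : Measurable (fun x => ENNReal.ofReal ((trProd QX n x / trProd QY n x) ^ p)) :=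
    ((hRX.div hRY).pow_const p).ennreal_ofReal
  rw [hmain, Jn, mul_comm (ENNReal.ofReal _), mul_comm (ENNReal.ofReal _),
    ← lintegral_mul_const _ hmJ, ← lintegral_mul_const _ hmJ]
  constructor
  · refine lintegral_mono fun x => ?_
    gcongr
    have e : (C1 * C2)⁻¹ * ((n:ℝ) ^ 2)⁻¹ = (C2 * n)⁻¹ * (C1 * n)⁻¹ := by
      field_simp
    rw [e, ENNReal.ofReal_mul (by positivity)]
    exact mul_le_mul' (hb2 n hn x p hp1 hp2).2 (hb1 n hn x (-p) (by linarith) (by linarith)).2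
  · refine lintegral_mono fun x => ?_
    gcongr
    have e : C1 * C2 * (n:ℝ) ^ 2 = (C2 * n) * (C1 * n) := by ring
    rw [e, ENNReal.ofReal_mul (by positivity)]
    exact mul_le_mul' (hb2 n hn x p hp1 hp2).1 (hb1 n hn x (-p) (by linarith) (by linarith)).1

end helpers

/-- The scaled cumulant generating function
`Λ(p) = lim (1/n) log E[(W_n(X|Y)/W_n(X|X'))^p]` is real-analytic and convex on `(-1,1)`. -/
theorem stmt9
    {A : Type*} [Fintype A] [Nonempty A] [MeasurableSpace A] [MeasurableSingletonClass A]
    (QX QY : A → A → ℝ) (μ μt : A → ℝ)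
    (hQXpos : ∀ x y, 0 < QX x y) (hQXrow : ∀ x, ∑ y, QX x y = 1)
    (hQYpos : ∀ x y, 0 < QY x y) (hQYrow : ∀ x, ∑ y, QY x y = 1)
    (hμnonneg : ∀ x, 0 ≤ μ x) (hμsum : ∑ x, μ x = 1)
    (hμstat : ∀ y, ∑ x, μ x * QX x y = μ y)
    (hμtnonneg : ∀ x, 0 ≤ μt x) (hμtsum : ∑ x, μt x = 1)
    (hμtstat : ∀ y, ∑ x, μt x * QY x y = μt y)
    (P Pt : Measure (ℕ → A)) [IsProbabilityMeasure P] [IsProbabilityMeasure Pt]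
    (hP : ∀ (n : ℕ) (a : ℕ → A),
      (P {ω | ∀ i ≤ n, ω i = a i}).toReal
        = μ (a 0) * ∏ i ∈ Finset.range n, QX (a i) (a (i + 1)))
    (hPt : ∀ (n : ℕ) (a : ℕ → A),
      (Pt {ω | ∀ i ≤ n, ω i = a i}).toReal
        = μt (a 0) * ∏ i ∈ Finset.range n, QY (a i) (a (i + 1)))
    (Lam : ℝ → ℝ)
    (hLam : ∀ p ∈ Set.Ioo (-1 : ℝ) 1,
      Tendsto (fun n : ℕ =>
          Real.log (∫ z, ((waitingTime n z.1.1 z.1.2 : ℝ) / (waitingTime n z.1.1 z.2 : ℝ)) ^ p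
            ∂((P.prod Pt).prod P)) / n)
        atTop (nhds (Lam p))) :
    AnalyticOnNhd ℝ Lam (Set.Ioo (-1 : ℝ) 1) ∧ ConvexOn ℝ (Set.Ioo (-1 : ℝ) 1) Lam := by
  have hX1 : ∀ x y, QX x y ≤ 1 := fun x y => by
    rw [← hQXrow x]
    exact Finset.single_le_sum (fun b _ => (hQXpos x b).le) (Finset.mem_univ y)
  have hY1 : ∀ x y, QY x y ≤ 1 := fun x y => by
    rw [← hQYrow x]
    exact Finset.single_le_sum (fun b _ => (hQYpos x b).le) (Finset.mem_univ y)
  have hM : MarkovProp P QX := markovProp_of_cyl QX μ hQXpos P hP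
  have hMt : MarkovProp Pt QY := markovProp_of_cyl QY μt hQYpos Pt hPt
  obtain ⟨C, hC, hsand⟩ := sandwich (P := P) (Pt := Pt) hQXpos hQYpos hX1 hY1 hM hMt
  let M : ℝ → A → A → ℝ := fun p a b => QX a b * (QX a b / QY a b) ^ p
  have hMpos : ∀ p a b, 0 < M p a b := fun p a b =>
    mul_pos (hQXpos a b) (Real.rpow_pos_of_pos (div_pos (hQXpos a b) (hQYpos a b)) p)
  have hMc : ∀ a b, ContDiff ℝ ⊤ (fun p => M p a b) := by
    intro a b
    have : (fun p => M p a b) = fun p => QX a b * Real.exp (Real.log (QX a b / QY a b) * p) := by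
      funext p
      simp only [M, Real.rpow_def_of_pos (div_pos (hQXpos a b) (hQYpos a b))]
    rw [this]
    exact contDiff_const.mul (Real.contDiff_exp.comp (contDiff_const.mul contDiff_id))
  have key : ∀ p ∈ Set.Ioo (-1 : ℝ) 1, ∀ (l : ℝ) (v : A → ℝ), 0 < l → (∀ a, 0 < v a) →
      (∀ a, ∑ b, M p a b * v b = l * v a) →
      Lam p = Real.log l ∧ (∀ n, 0 < (Jn P QX QY n p).toReal) ∧ (∀ n, Jn P QX QY n p ≠ ⊤) ∧
      Tendsto (fun n : ℕ => Real.log (Jn P QX QY n p).toReal / n) atTop (nhds (Real.log l)) := by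
    intro p hp l v hl hv hMv
    obtain ⟨c, D, hc, hD, hJ⟩ := Jn_growth hQXpos hQYpos hM p l hl v hv hMv
    have hJtop : ∀ n, Jn P QX QY n p ≠ ⊤ := fun n =>
      ne_top_of_le_ne_top ENNReal.ofReal_ne_top (hJ n).2
    have hJlo : ∀ n, c * l ^ n ≤ (Jn P QX QY n p).toReal := fun n =>
      (ENNReal.ofReal_le_iff_le_toReal (hJtop n)).1 (hJ n).1
    have hJhi : ∀ n, (Jn P QX QY n p).toReal ≤ D * l ^ n := fun n =>
      ENNReal.toReal_le_of_le_ofReal (by positivity) (hJ n).2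
    refine ⟨?_, fun n => lt_of_lt_of_le (by positivity) (hJlo n), hJtop, ?_⟩
    · refine tendsto_nhds_unique (hLam p hp) ?_
      have hint : ∀ n : ℕ, ∫ z, ((waitingTime n z.1.1 z.1.2 : ℝ) /
          (waitingTime n z.1.1 z.2 : ℝ)) ^ p ∂((P.prod Pt).prod P)
          = (∫⁻ z, ENNReal.ofReal (((waitingTime n z.1.1 z.1.2 : ℝ) /
          (waitingTime n z.1.1 z.2 : ℝ)) ^ p) ∂((P.prod Pt).prod P)).toReal := by
        intro n
        refine integral_eq_lintegral_of_nonneg_ae (ae_of_all _ fun z => ?_) ?_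
        · exact Real.rpow_nonneg (by positivity) _
        · have hWm : Measurable (fun z : (ℕ → A) × (ℕ → A) => (waitingTime n z.1 z.2 : ℝ)) :=
            (Measurable.of_discrete (f := fun k : ℕ => (k : ℝ))).comp (waitingTime_measurable n)
          have hW1 : Measurable (fun z : ((ℕ → A) × (ℕ → A)) × (ℕ → A) =>
            (waitingTime n z.1.1 z.1.2 : ℝ)) := hWm.comp measurable_fst
          have hW2 : Measurable (fun z : ((ℕ → A) × (ℕ → A)) × (ℕ → A) =>
            (waitingTime n z.1.1 z.2 : ℝ)) :=
            hWm.comp ((measurable_fst.comp measurable_fst).prodMk measurable_snd)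
          exact ((hW1.div hW2).pow_const p).aestronglyMeasurable
      simp only [hint]
      refine growth_log _ (C⁻¹ * c) (C * D) l (by positivity) (by positivity) hl ?_ ?_
      · intro n hn
        have hn' : (0:ℝ) < n := by exact_mod_cast hn
        obtain ⟨h1, h2⟩ := hsand n hn p hp.1.le hp.2.le
        have htop : ∫⁻ z, ENNReal.ofReal (((waitingTime n z.1.1 z.1.2 : ℝ) /
          (waitingTime n z.1.1 z.2 : ℝ)) ^ p) ∂((P.prod Pt).prod P) ≠ ⊤ :=
          ne_top_of_le_ne_top (ENNReal.mul_ne_top ENNReal.ofReal_ne_top (hJtop n)) h2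
        have h3 := ENNReal.toReal_mono htop h1
        rw [ENNReal.toReal_mul, ENNReal.toReal_ofReal (by positivity)] at h3
        refine le_trans ?_ h3
        calc C⁻¹ * c * ((n:ℝ) ^ 2)⁻¹ * l ^ n = C⁻¹ * ((n:ℝ) ^ 2)⁻¹ * (c * l ^ n) := by ring
          _ ≤ _ := mul_le_mul_of_nonneg_left (hJlo n) (by positivity)
      · intro n hn
        obtain ⟨h1, h2⟩ := hsand n hn p hp.1.le hp.2.le
        have h3 := ENNReal.toReal_mono (ENNReal.mul_ne_top ENNReal.ofReal_ne_top (hJtop n)) h2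
        rw [ENNReal.toReal_mul, ENNReal.toReal_ofReal (by positivity)] at h3
        refine h3.trans ?_
        calc _ ≤ C * (n:ℝ) ^ 2 * (D * l ^ n) := mul_le_mul_of_nonneg_left (hJhi n) (by positivity)
          _ = _ := by ring
    · refine growth_log _ c D l hc hD hl ?_ ?_
      · intro n hn
        have hn' : (1:ℝ) ≤ (n:ℝ) ^ 2 := one_le_pow₀ (by exact_mod_cast hn)
        refine le_trans ?_ (hJlo n)
        refine mul_le_mul_of_nonneg_right ?_ (by positivity)
        exact mul_le_of_le_one_right hc.le (inv_le_one_of_one_le₀ hn')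
      · intro n hn
        have hn' : (1:ℝ) ≤ (n:ℝ) ^ 2 := one_le_pow₀ (by exact_mod_cast hn)
        refine (hJhi n).trans ?_
        refine mul_le_mul_of_nonneg_right ?_ (by positivity)
        exact le_mul_of_one_le_right hD.le hn'
  have key2 : ∀ p ∈ Set.Ioo (-1 : ℝ) 1, (∀ n, 0 < (Jn P QX QY n p).toReal) ∧
      (∀ n, Jn P QX QY n p ≠ ⊤) ∧
      Tendsto (fun n : ℕ => Real.log (Jn P QX QY n p).toReal / n) atTop (nhds (Lam p)) := by
    intro p hp
    obtain ⟨l, hl, v, hv, -, hMv⟩ := perron_exists (M p) (hMpos p)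
    obtain ⟨h1, h2, h3, h4⟩ := key p hp l v hl hv hMv
    rw [h1]
    exact ⟨h2, h3, h4⟩
  constructor
  · intro p0 hp0
    obtain ⟨l, hla, hl0, hev⟩ := perron_analytic M hMpos hMc p0
    have hlog : AnalyticAt ℝ (fun p => Real.log (l p)) p0 := hla.log hl0
    refine hlog.congr ?_
    filter_upwards [hev, isOpen_Ioo.mem_nhds hp0,
      hla.continuousAt.eventually (eventually_gt_nhds hl0)] with p hp1 hp2 hp3
    obtain ⟨v, hv, hMv⟩ := hp1
    exact (key p hp2 (l p) v hp3 hv hMv).1.symm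
  · refine ⟨convex_Ioo _ _, ?_⟩
    intro p hp q hq a b ha hb hab
    have hpq : a • p + b • q ∈ Set.Ioo (-1 : ℝ) 1 := convex_Ioo _ _ hp hq ha hb hab
    obtain ⟨hp1, hp2, hp3⟩ := key2 p hp
    obtain ⟨hq1, hq2, hq3⟩ := key2 q hq
    obtain ⟨hr1, hr2, hr3⟩ := key2 _ hpq
    refine le_of_tendsto_of_tendsto' hr3 ((hp3.const_smul a).add (hq3.const_smul b)) fun n => ?_
    have h := Jn_holder (P := P) hQXpos hQYpos n p q a b ha hb hab
    have h' := ENNReal.toReal_mono (ENNReal.mul_ne_top (ENNReal.rpow_ne_top_of_nonneg ha (hp2 n))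
      (ENNReal.rpow_ne_top_of_nonneg hb (hq2 n))) h
    rw [ENNReal.toReal_mul, ← ENNReal.toReal_rpow, ← ENNReal.toReal_rpow] at h'
    have h2 := Real.log_le_log (hr1 n) h'
    rw [Real.log_mul (Real.rpow_pos_of_pos (hp1 n) a).ne' (Real.rpow_pos_of_pos (hq1 n) b).ne',
      Real.log_rpow (hp1 n), Real.log_rpow (hq1 n)] at h2
    have h3 := div_le_div_of_nonneg_right h2 (Nat.cast_nonneg (α := ℝ) n)
    simp only [smul_eq_mul]
    refine h3.trans (le_of_eq ?_)
    ring
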